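/- arXiv:1703.06821 — 7 statements merged into one kernel-verified Lean document; each statement's English description precedes it below -/
import Mathlib

section
/- Let K be a field and V = K^6. There exists a nonzero alternating trilinear form χ on V such that dim Rad_χ(u) = 2 for every nonzero u ∈ V (equivalently, such that the upper radical R↑(χ) is a line spread of the projective space of V, every nonzero vector lying on exactly one of its members) if and only if K is not quadratically closed, i.e., there exist a, b ∈ K such that x² + a·x + b ≠ 0 for every x ∈ K. -/
open Module

/-- The radical of a point `u` with respect to an alternating trilinear form `χ` on `V`:
the subspace `Rad_χ(u) = {v ∈ V | χ(u, v, x) = 0 for all x ∈ V}`. -/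
def trilinRad {K V : Type*} [Field K] [AddCommGroup V] [Module K V]
    (χ : AlternatingMap K V K (Fin 3)) (u : V) : Submodule K V where
  carrier := {v | ∀ x : V, χ ![u, v, x] = 0}
  add_mem' := by
    intro a b ha hb x
    have h1 : (![u, a + b, x] : Fin 3 → V) = Function.update ![u, a, x] 1 (a + b) := by
      funext i; fin_cases i <;> simp
    have h2 : Function.update (![u, a, x] : Fin 3 → V) 1 a = ![u, a, x] := by
      funext i; fin_cases i <;> simp
    have h3 : Function.update (![u, a, x] : Fin 3 → V) 1 b = ![u, b, x] := by
      funext i; fin_cases i <;> simp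
    calc χ ![u, a + b, x]
        = χ (Function.update ![u, a, x] 1 (a + b)) := by rw [h1]
      _ = χ (Function.update ![u, a, x] 1 a) + χ (Function.update ![u, a, x] 1 b) := by
          rw [AlternatingMap.map_update_add]
      _ = 0 := by rw [h2, h3, ha x, hb x, add_zero]
  zero_mem' := by
    intro x
    exact AlternatingMap.map_coord_zero χ 1 (by simp)
  smul_mem' := by
    intro c a ha x
    have h1 : (![u, c • a, x] : Fin 3 → V) = Function.update ![u, a, x] 1 (c • a) := by
      funext i; fin_cases i <;> simp
    have h2 : Function.update (![u, a, x] : Fin 3 → V) 1 a = ![u, a, x] := by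
      funext i; fin_cases i <;> simp
    rw [h1, AlternatingMap.map_update_smul, h2, ha x, smul_zero]

/-- The basic alternating trilinear form `[ijk]` on `K^n`, sending `(x, y, z)` to the
determinant of the 3×3 matrix with rows `(x i, x j, x k)`, `(y i, y j, y k)`,
`(z i, z j, z k)`.  (Indices are 0-based: the form written `[123]` in the paper is
`trip 0 1 2`.) -/
noncomputable def trip {K : Type*} [Field K] {n : ℕ} (i j k : Fin n) :
    AlternatingMap K (Fin n → K) K (Fin 3) :=
  (Matrix.detRowAlternating : AlternatingMap K (Fin 3 → K) K (Fin 3)).compLinearMap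
    (LinearMap.funLeft K K ![i, j, k])

section PfaffianPencil

variable {K V : Type*} [Field K] [AddCommGroup V] [Module K V]

/-- An alternating trilinear form as an iterated linear map. -/
def trilinToLin (χ : AlternatingMap K V K (Fin 3)) : V →ₗ[K] V →ₗ[K] V →ₗ[K] K where
  toFun u :=
    { toFun := fun v =>
        { toFun := fun x => χ ![u, v, x]
          map_add' := fun x y => by
            exact ((χ.curryLeft u).curryLeft v).map_vecCons_add ![] x y
          map_smul' := fun c x => by
            exact ((χ.curryLeft u).curryLeft v).map_vecCons_smul ![] c x }
      map_add' := fun v w => by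
        ext x
        exact (χ.curryLeft u).map_vecCons_add ![x] v w
      map_smul' := fun c v => by
        ext x
        exact (χ.curryLeft u).map_vecCons_smul ![x] c v }
  map_add' u w := by
    ext v x
    exact χ.map_vecCons_add ![v, x] u w
  map_smul' c u := by
    ext v x
    exact χ.map_vecCons_smul ![v, x] c u

theorem trilinToLin_apply (χ : AlternatingMap K V K (Fin 3)) (u v x : V) :
    trilinToLin χ u v x = χ ![u, v, x] := rfl

theorem mem_trilinRad {χ : AlternatingMap K V K (Fin 3)} {u v : V} :
    v ∈ trilinRad χ u ↔ ∀ x, trilinToLin χ u v x = 0 := Iff.rfl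

theorem trilinToLin_self (χ : AlternatingMap K V K (Fin 3)) (u x : V) :
    trilinToLin χ u u x = 0 :=
  χ.map_eq_zero_of_eq _ (i := 0) (j := 1) rfl (by decide)

theorem trilinToLin_self_right (χ : AlternatingMap K V K (Fin 3)) (u x : V) :
    trilinToLin χ u x x = 0 :=
  χ.map_eq_zero_of_eq _ (i := 1) (j := 2) rfl (by decide)

theorem trilinToLin_swap (χ : AlternatingMap K V K (Fin 3)) (u v x : V) :
    trilinToLin χ u v x = -trilinToLin χ v u x := by
  have h := trilinToLin_self χ (u + v) x
  simp only [map_add, LinearMap.add_apply, trilinToLin_self] at h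
  linear_combination h

theorem trilinToLin_swap_right (χ : AlternatingMap K V K (Fin 3)) (u v x : V) :
    trilinToLin χ u v x = -trilinToLin χ u x v := by
  have h := trilinToLin_self_right χ u (v + x)
  simp only [map_add, LinearMap.add_apply, trilinToLin_self_right] at h
  linear_combination h

/-- All points on a radical of dimension two share that radical. -/
theorem trilinRad_eq_of_mem {χ : AlternatingMap K V K (Fin 3)}
    (h : ∀ u : V, u ≠ 0 → finrank K (trilinRad χ u) = 2) {u y : V} (hu : u ≠ 0) (hy : y ≠ 0)
    (hyu : y ∈ trilinRad χ u) : trilinRad χ y = trilinRad χ u := by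
  have : FiniteDimensional K (trilinRad χ y) := .of_finrank_pos (by rw [h y hy]; norm_num)
  have huy : u ∈ trilinRad χ y := fun x => by
    rw [← trilinToLin_apply, trilinToLin_swap, mem_trilinRad.1 hyu, neg_zero]
  refine (Submodule.eq_of_le_of_finrank_eq (fun v hv => ?_) (by rw [h u hu, h y hy])).symm
  by_cases hc : ∃ c : K, c • u = y
  · obtain ⟨c, rfl⟩ := hc
    rw [mem_trilinRad]
    simp [mem_trilinRad.1 hv]
  · have : FiniteDimensional K (trilinRad χ u) := .of_finrank_pos (by rw [h u hu]; norm_num)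
    have hli : LinearIndependent K ![u, y] :=
      (LinearIndependent.pair_iff' hu).2 (by simpa using hc)
    have hle : Submodule.span K {u, y} ≤ trilinRad χ u := by
      rw [Submodule.span_le]
      rintro z (rfl | rfl)
      exacts [trilinToLin_self χ z, hyu]
    have hspan : Submodule.span K {u, y} = trilinRad χ u := by
      refine Submodule.eq_of_le_of_finrank_eq hle ?_
      rw [h u hu, ← Matrix.range_cons_cons_empty u y ![], finrank_span_eq_card hli,
        Fintype.card_fin]
    rw [← hspan] at hv
    refine Submodule.span_le.2 ?_ hv
    rintro z (rfl | rfl)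
    exacts [huy, trilinToLin_self χ z]

/-- The Pfaffian of the Gram matrix of a quadruple with respect to the alternating form
`χ(u, ·, ·)`. -/
def trilinPf (χ : AlternatingMap K V K (Fin 3)) (w : Fin 4 → V) (u : V) : K :=
  trilinToLin χ u (w 0) (w 1) * trilinToLin χ u (w 2) (w 3) -
    trilinToLin χ u (w 0) (w 2) * trilinToLin χ u (w 1) (w 3) +
    trilinToLin χ u (w 0) (w 3) * trilinToLin χ u (w 1) (w 2)

theorem det_gram_eq_trilinPf_sq (χ : AlternatingMap K V K (Fin 3)) (w : Fin 4 → V) (u : V) :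
    (Matrix.of fun i j => trilinToLin χ u (w i) (w j)).det = trilinPf χ w u ^ 2 := by
  have e10 := trilinToLin_swap_right χ u (w 1) (w 0)
  have e20 := trilinToLin_swap_right χ u (w 2) (w 0)
  have e30 := trilinToLin_swap_right χ u (w 3) (w 0)
  have e21 := trilinToLin_swap_right χ u (w 2) (w 1)
  have e31 := trilinToLin_swap_right χ u (w 3) (w 1)
  have e32 := trilinToLin_swap_right χ u (w 3) (w 2)
  rw [Matrix.det_succ_row_zero]
  simp [Fin.sum_univ_four, Matrix.det_fin_three, Fin.succAbove, trilinToLin_self_right, trilinPf]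
  rw [e10, e20, e30, e21, e31, e32]
  ring

/-- The form induced by `χ(y, ·, ·)` on a complement of the radical of `y` is nondegenerate. -/
theorem trilinPf_ne_zero {χ : AlternatingMap K V K (Fin 3)} {y : V} {W : Submodule K V}
    (hW : IsCompl (trilinRad χ y) W) (b : Basis (Fin 4) K W) :
    trilinPf χ (fun i => (b i : V)) y ≠ 0 := by
  intro h0
  have hdet := det_gram_eq_trilinPf_sq χ (fun i => (b i : V)) y
  rw [h0, zero_pow two_ne_zero, ← Matrix.exists_mulVec_eq_zero_iff] at hdet
  obtain ⟨c, hc, hc0⟩ := hdet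
  set z : W := ∑ j, c j • b j with hz
  have hwz (w : W) : trilinToLin χ y w z = 0 := by
    suffices (trilinToLin χ y).flip z ∘ₗ W.subtype = 0 from LinearMap.congr_fun this w
    refine b.ext fun i => ?_
    have := congrFun hc0 i
    simp only [Matrix.mulVec, dotProduct, Matrix.of_apply, Pi.zero_apply] at this
    simpa [hz, mul_comm] using this
  have hzrad : (z : V) ∈ trilinRad χ y := by
    rw [mem_trilinRad]
    intro x
    obtain ⟨r, hr, w, hw, rfl⟩ := Submodule.mem_sup.1 (hW.sup_eq_top ▸ Submodule.mem_top (x := x))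
    rw [trilinToLin_swap_right, map_add, LinearMap.add_apply, mem_trilinRad.1 hr, hwz ⟨w, hw⟩]
    simp
  have hz0 : z = 0 := by
    simpa using Submodule.disjoint_def.1 hW.disjoint _ hzrad z.2
  exact hc (funext (Fintype.linearIndependent_iff.1 b.linearIndependent c hz0))

/-- Along a radical of dimension two in a space of dimension six, the Pfaffian is a binary
quadratic form without nontrivial zeros. -/
theorem exists_quadratic_without_root [FiniteDimensional K V] (hV : finrank K V = 6)
    {χ : AlternatingMap K V K (Fin 3)}
    (h : ∀ u : V, u ≠ 0 → finrank K (trilinRad χ u) = 2) :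
    ∃ a b : K, ∀ x : K, x ^ 2 + a * x + b ≠ 0 := by
  have : Nontrivial V := nontrivial_of_finrank_pos (R := K) (by omega)
  obtain ⟨u, hu⟩ := exists_ne (0 : V)
  obtain ⟨W, hW⟩ := (trilinRad χ u).exists_isCompl
  have hfW : finrank K W = 4 := by
    have := Submodule.finrank_add_eq_of_isCompl hW
    rw [h u hu] at this
    omega
  let b : Basis (Fin 4) K W := finBasisOfFinrankEq K W hfW
  have hpf {y : V} (hy : y ≠ 0) (hyu : y ∈ trilinRad χ u) :
      trilinPf χ (fun i => (b i : V)) y ≠ 0 :=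
    trilinPf_ne_zero (by rwa [trilinRad_eq_of_mem h hu hy hyu]) b
  have huu : u ∈ trilinRad χ u := trilinToLin_self χ u
  obtain ⟨v, hv, hvu⟩ : ∃ v ∈ trilinRad χ u, v ∉ Submodule.span K {u} := by
    by_contra! hle
    have := Submodule.finrank_mono (R := K) (s := trilinRad χ u) (t := Submodule.span K {u}) hle
    rw [h u hu, finrank_span_singleton hu] at this
    omega
  set p := trilinPf χ (fun i => (b i : V)) u with hp
  have hp0 : p ≠ 0 := hpf hu huu
  set r := trilinPf χ (fun i => (b i : V)) v with hr
  set q := trilinPf χ (fun i => (b i : V)) (u + v) - p - r with hq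
  refine ⟨q / p, r / p, fun x hx => ?_⟩
  have hxv : x • u + v ≠ 0 := by
    intro h0
    refine hvu (Submodule.mem_span_singleton.2 ⟨-x, ?_⟩)
    rw [neg_smul]
    exact neg_eq_of_add_eq_zero_right h0
  refine hpf hxv (add_mem (Submodule.smul_mem _ x huu) hv) ?_
  have hx' : p * x ^ 2 + q * x + r = 0 := by
    field_simp at hx
    linear_combination hx
  rw [← hx', hq, hp, hr]
  simp only [trilinPf, map_add, map_smul, LinearMap.add_apply, LinearMap.smul_apply, smul_eq_mul]
  ring

end PfaffianPencil

section QuadraticExtension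

/-- In `L^3`, if `det(a, b, x) = 0` for all `x` and `a` is nonzero, then `b` is a multiple
of `a`. -/
theorem exists_smul_eq_of_det_eq_zero {L : Type*} [Field L] {a b : Fin 3 → L} (ha : a ≠ 0)
    (h : ∀ x : Fin 3 → L, (Matrix.of ![a, b, x]).det = 0) : ∃ c : L, c • a = b := by
  have h0 := h ![1, 0, 0]
  have h1 := h ![0, 1, 0]
  have h2 := h ![0, 0, 1]
  simp [Matrix.det_fin_three] at h0 h1 h2
  obtain ⟨i, hi⟩ := Function.ne_iff.1 ha
  refine ⟨b i / a i, funext fun j => ?_⟩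
  simp only [Pi.smul_apply, smul_eq_mul]
  rw [div_mul_eq_mul_div, div_eq_iff hi]
  fin_cases i <;> fin_cases j <;> simp <;> grind

/-- A `K`-linear functional applied to the determinant on `L^3`. -/
def detTrilin {K L V : Type*} [Field K] [Field L] [Algebra K L] [AddCommGroup V] [Module K V]
    (l : L →ₗ[K] K) (e : V ≃ₗ[K] (Fin 3 → L)) : AlternatingMap K V K (Fin 3) :=
  let d : AlternatingMap K (Fin 3 → L) L (Fin 3) :=
    { (Matrix.detRowAlternating (R := L) (n := Fin 3)).toMultilinearMap.restrictScalars K with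
      map_eq_zero_of_eq' := (Matrix.detRowAlternating (R := L) (n := Fin 3)).map_eq_zero_of_eq' }
  l.compAlternatingMap (d.compLinearMap e.toLinearMap)

theorem detTrilin_apply {K L V : Type*} [Field K] [Field L] [Algebra K L] [AddCommGroup V]
    [Module K V] (l : L →ₗ[K] K) (e : V ≃ₗ[K] (Fin 3 → L)) (u v x : V) :
    detTrilin l e ![u, v, x] = l (Matrix.of ![e u, e v, e x]).det := by
  change l (Matrix.det (Matrix.of fun i => e (![u, v, x] i))) = _
  congr 2

theorem trilinRad_detTrilin {K L V : Type*} [Field K] [Field L] [Algebra K L] [AddCommGroup V]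
    [Module K V] {l : L →ₗ[K] K} (hl : l 1 ≠ 0) (e : V ≃ₗ[K] (Fin 3 → L)) {u : V} (hu : u ≠ 0) :
    trilinRad (detTrilin l e) u =
      LinearMap.range (e.symm.toLinearMap ∘ₗ
        (LinearMap.toSpanSingleton L (Fin 3 → L) (e u)).restrictScalars K) := by
  ext v
  constructor
  · intro hv
    have hdet (x : Fin 3 → L) : (Matrix.of ![e u, e v, x]).det = 0 := by
      by_contra hd
      refine hl ?_
      have := hv (e.symm ((Matrix.of ![e u, e v, x]).det⁻¹ • x))
      rw [detTrilin_apply, e.apply_symm_apply] at this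
      rw [← this, ← inv_mul_cancel₀ hd]
      congr 1
      simp [Matrix.det_fin_three]
      ring
    obtain ⟨c, hc⟩ := exists_smul_eq_of_det_eq_zero (by simpa using hu) hdet
    exact ⟨c, by simp [hc]⟩
  · rintro ⟨c, rfl⟩ x
    rw [detTrilin_apply]
    convert l.map_zero
    simp [Matrix.det_fin_three]
    ring

theorem finrank_trilinRad_detTrilin {K L V : Type*} [Field K] [Field L] [Algebra K L]
    [AddCommGroup V] [Module K V] {l : L →ₗ[K] K} (hl : l 1 ≠ 0) (e : V ≃ₗ[K] (Fin 3 → L))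
    {u : V} (hu : u ≠ 0) : finrank K (trilinRad (detTrilin l e) u) = finrank K L := by
  rw [trilinRad_detTrilin hl e hu]
  refine LinearMap.finrank_range_of_inj (e.symm.injective.comp ?_)
  exact smul_left_injective L (by simpa using hu)

theorem exists_trilin_of_finrank_eq_two {K L : Type*} [Field K] [Field L] [Algebra K L]
    (hL : finrank K L = 2) :
    ∃ χ : AlternatingMap K (Fin 6 → K) K (Fin 3),
      ∀ u : Fin 6 → K, u ≠ 0 → finrank K (trilinRad χ u) = 2 := by
  have : FiniteDimensional K L := .of_finrank_pos (by omega)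
  obtain ⟨l, hl⟩ : ∃ l : L →ₗ[K] K, l 1 ≠ 0 := by
    by_contra! hl
    exact one_ne_zero ((forall_dual_apply_eq_zero_iff K (1 : L)).1 hl)
  have e : (Fin 6 → K) ≃ₗ[K] (Fin 3 → L) :=
    LinearEquiv.ofFinrankEq _ _ (by rw [finrank_fin_fun, finrank_pi_fintype]; simp [hL])
  exact ⟨detTrilin l e, fun u hu => (finrank_trilinRad_detTrilin hl e hu).trans hL⟩

open Polynomial in
theorem exists_trilin_of_quadratic_without_root {K : Type*} [Field K] {a b : K}
    (hab : ∀ x : K, x ^ 2 + a * x + b ≠ 0) :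
    ∃ χ : AlternatingMap K (Fin 6 → K) K (Fin 3),
      ∀ u : Fin 6 → K, u ≠ 0 → finrank K (trilinRad χ u) = 2 := by
  have hdeg : (X ^ 2 + C a * X + C b : K[X]).natDegree = 2 := by compute_degree!
  have hirr : Irreducible (X ^ 2 + C a * X + C b : K[X]) := by
    refine irreducible_of_degree_le_three_of_not_isRoot (by simp [hdeg]) fun x hx => hab x ?_
    simpa using hx
  have : Fact (Irreducible (X ^ 2 + C a * X + C b : K[X])) := ⟨hirr⟩
  refine exists_trilin_of_finrank_eq_two
    (L := AdjoinRoot (X ^ 2 + C a * X + C b : K[X])) ?_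
  rw [(AdjoinRoot.powerBasis hirr.ne_zero).finrank, AdjoinRoot.powerBasis_dim, hdeg]

end QuadraticExtension

/-- there is a nonzero alternating trilinear form on `K^6` all of whose
nonzero points have radical of dimension 2 (i.e. whose upper radical is a line spread)
iff `K` is not quadratically closed. -/
theorem stmt0 (K : Type*) [Field K] :
    (∃ χ : AlternatingMap K (Fin 6 → K) K (Fin 3), χ ≠ 0 ∧
        ∀ u : Fin 6 → K, u ≠ 0 → Module.finrank K (trilinRad χ u) = 2) ↔
      (∃ a b : K, ∀ x : K, x ^ 2 + a * x + b ≠ 0) := by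
  constructor
  · rintro ⟨χ, -, h⟩
    exact exists_quadratic_without_root (finrank_fin_fun K) h
  · rintro ⟨a, b, hab⟩
    obtain ⟨χ, h⟩ := exists_trilin_of_quadratic_without_root hab
    refine ⟨χ, ?_, h⟩
    rintro rfl
    have htop : trilinRad (0 : AlternatingMap K (Fin 6 → K) K (Fin 3)) 1 = ⊤ :=
      eq_top_iff.2 fun v _ x => rfl
    have := h 1 one_ne_zero
    rw [htop, finrank_top, finrank_fin_fun] at this
    omega
end

section
/- Let K be a field, let n ≥ 3 be an odd natural number, and let χ be a nonzero alternating trilinear form on V = K^n. Suppose that not every nonzero vector of V is a pole of χ. Then there exists a nonzero homogeneous polynomial g ∈ K[X_1, …, X_n] of degree at most (n − 3)/2 such that for every nonzero u ∈ K^n, u is a pole of χ if and only if g(u_1, …, u_n) = 0. -/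
open Module

/-- The determinant of an alternating matrix over a field is a square. -/
theorem isSquare_det_of_alternating {F ι : Type*} [Field F] [Fintype ι] [DecidableEq ι]
    (M : Matrix ι ι F) (hdiag : ∀ i, M i i = 0) (hanti : ∀ i j, M i j = -M j i) :
    IsSquare M.det := by
  induction hc : Fintype.card ι using Nat.strong_induction_on generalizing ι with
  | _ c ih =>
    rcases isEmpty_or_nonempty ι with hι | hι
    · simp
    by_cases h0 : M = 0
    · simp [h0]
    obtain ⟨i, j, hij⟩ : ∃ i j, M i j ≠ 0 := by
      by_contra! h
      exact h0 (Matrix.ext h)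
    have hne : i ≠ j := by
      rintro rfl
      exact hij (hdiag i)
    let e : Fin 2 ⊕ {x // x ≠ i ∧ x ≠ j} ≃ ι :=
      Equiv.ofBijective (Sum.elim ![i, j] Subtype.val) (by
        constructor
        · rintro (a | ⟨a, ha⟩) (b | ⟨b, hb⟩) hab
          · fin_cases a <;> fin_cases b
            exacts [rfl, absurd hab hne, absurd hab hne.symm, rfl]
          · fin_cases a
            exacts [absurd hab.symm hb.1, absurd hab.symm hb.2]
          · fin_cases b
            exacts [absurd hab ha.1, absurd hab ha.2]
          · simpa using hab
        · intro x
          by_cases hx : x = i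
          · exact ⟨Sum.inl 0, by simp [hx]⟩
          by_cases hy : x = j
          · exact ⟨Sum.inl 1, by simp [hy]⟩
          exact ⟨Sum.inr ⟨x, hx, hy⟩, by simp⟩)
    set a := M i j
    let A : Matrix (Fin 2) (Fin 2) F := !![0, a; -a, 0]
    let A' : Matrix (Fin 2) (Fin 2) F := !![0, -a⁻¹; a⁻¹, 0]
    have hAA' : A * A' = 1 := by
      simp [A, A', Matrix.one_fin_two, hij]
    have hA'A : A' * A = 1 := by
      simp [A, A', Matrix.one_fin_two, hij]
    let B : Matrix (Fin 2) {x // x ≠ i ∧ x ≠ j} F := Matrix.of fun k x => M (![i, j] k) x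
    let C : Matrix {x // x ≠ i ∧ x ≠ j} (Fin 2) F := Matrix.of fun x k => M x (![i, j] k)
    let D : Matrix {x // x ≠ i ∧ x ≠ j} {x // x ≠ i ∧ x ≠ j} F := Matrix.of fun x y => M x y
    have hblocks : M.submatrix e e = Matrix.fromBlocks A B C D := by
      ext (k | x) (l | y)
      · fin_cases k <;> fin_cases l
        exacts [hdiag i, rfl, hanti j i, hdiag j]
      all_goals rfl
    let _ : Invertible A := ⟨A', hA'A, hAA'⟩
    have hdet : M.det = A.det * (D - C * A' * B).det := by
      rw [← Matrix.det_submatrix_equiv_self e M, hblocks, Matrix.det_fromBlocks₁₁]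
      rfl
    have hcard : Fintype.card {x // x ≠ i ∧ x ≠ j} < c := by
      rw [← hc]
      exact Fintype.card_subtype_lt (x := i) (by simp)
    have hentry : ∀ x y, (D - C * A' * B) x y
        = M x y - (M x j * a⁻¹ * M i y - M x i * a⁻¹ * M j y) := by
      intro x y
      simp [Matrix.mul_apply, Fin.sum_univ_two, A', B, C, D]
      ring
    rw [hdet]
    refine IsSquare.mul ⟨a, by simp [A, Matrix.det_fin_two]⟩ (ih _ hcard _ ?_ ?_ rfl)
    · intro x
      rw [hentry, hdiag, hanti x j, hanti x i]
      ring
    · intro x y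
      rw [hentry, hentry, hanti x y, hanti x j, hanti x i, hanti i y, hanti j y]
      ring

/-- Vectors annihilated by `M` are proportional as soon as some cofactor of `M` is nonzero. -/
theorem mul_eq_mul_of_mulVec_eq_zero {R ι : Type*} [CommRing R] [IsDomain R] [Fintype ι]
    [DecidableEq ι] {M : Matrix ι ι R} {p q : ι} (hpq : M.adjugate p q ≠ 0) {v w : ι → R}
    (hv : M.mulVec v = 0) (hw : M.mulVec w = 0) (i : ι) : v p * w i = w p * v i := by
  rw [Matrix.adjugate_apply] at hpq
  have hz : v p • w - w p • v = 0 := by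
    by_contra hne
    refine hpq (Matrix.exists_mulVec_eq_zero_iff.mp ⟨_, hne, ?_⟩)
    ext k
    by_cases hk : k = q
    · subst hk
      simp [Matrix.mulVec, mul_comm]
    · have h1 := congrFun hv k
      have h2 := congrFun hw k
      simp only [Matrix.mulVec, Pi.zero_apply] at h1 h2
      simp [Matrix.mulVec, Matrix.updateRow_ne hk, h1, h2]
  have := congrFun hz i
  simpa [sub_eq_zero] using this

/-- If `M *ᵥ u = 0`, `u ᵥ* M = 0` and `u p ≠ 0`, the kernel of `M` is the line through `u`
exactly when the principal cofactor of `M` at `p` is nonzero. -/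
theorem finrank_ker_le_one_iff_adjugate_ne_zero {K ι : Type*} [Field K] [Fintype ι]
    [DecidableEq ι] {M : Matrix ι ι K} {u : ι → K} (hu : M.mulVec u = 0)
    (hu' : Matrix.vecMul u M = 0) {p : ι} (hp : u p ≠ 0) :
    finrank K (LinearMap.ker M.mulVecLin) ≤ 1 ↔ M.adjugate p p ≠ 0 := by
  constructor
  · intro h hadj
    rw [Matrix.adjugate_apply] at hadj
    obtain ⟨v, hv0, hv⟩ := Matrix.exists_mulVec_eq_zero_iff.mpr hadj
    have hvp : v p = 0 := by
      have := congrFun hv p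
      simpa [Matrix.mulVec] using this
    have hvk : ∀ k, k ≠ p → M.mulVec v k = 0 := by
      intro k hk
      have := congrFun hv k
      simpa [Matrix.mulVec, Matrix.updateRow_ne hk] using this
    have hMv : M.mulVec v = 0 := by
      ext k
      by_cases hk : k = p
      · subst hk
        have h1 : u ⬝ᵥ M.mulVec v = 0 := by
          rw [Matrix.dotProduct_mulVec, hu', zero_dotProduct]
        rw [dotProduct, Fintype.sum_eq_single k fun l hl => by simp [hvk l hl]] at h1
        simpa [hp] using h1
      · simpa using hvk k hk
    obtain ⟨w, hw⟩ := finrank_le_one_iff.mp h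
    obtain ⟨a, ha⟩ := hw ⟨u, by simpa using hu⟩
    obtain ⟨b, hb⟩ := hw ⟨v, by simpa using hMv⟩
    have ha' : a • (w : ι → K) = u := congrArg Subtype.val ha
    have hb' : b • (w : ι → K) = v := congrArg Subtype.val hb
    have hwp : (w : ι → K) p ≠ 0 := by
      intro h0
      apply hp
      rw [← ha']
      simp [h0]
    have hb0 : b = 0 := by
      rw [← hb'] at hvp
      simpa [hwp] using hvp
    exact hv0 (by rw [← hb', hb0, zero_smul])
  · intro hadj
    refine finrank_le_one ⟨u, by simpa using hu⟩ fun w => ⟨w.1 p / u p, Subtype.ext ?_⟩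
    have hw : M.mulVec w.1 = 0 := w.2
    ext i
    have := mul_eq_mul_of_mulVec_eq_zero hadj hu hw i
    simp only [Submodule.coe_smul, Pi.smul_apply, smul_eq_mul]
    field_simp
    exact this.symm

open MvPolynomial in
/-- A square root of a homogeneous polynomial is homogeneous. -/
theorem isHomogeneous_of_mul_self {R σ : Type*} [CommRing R] [IsDomain R]
    {h : MvPolynomial σ R} {d : ℕ} (hd : (h * h).IsHomogeneous d) :
    h.IsHomogeneous h.totalDegree := by
  by_cases h0 : h = 0
  · simp [h0, isHomogeneous_zero]
  have hdeg : d = h.totalDegree + h.totalDegree := by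
    rw [← hd.totalDegree (mul_ne_zero h0 h0), totalDegree_mul_of_isDomain h0 h0]
  set e := h.totalDegree with he
  set t := homogeneousComponent e h with ht
  have htop : t.IsHomogeneous e := homogeneousComponent_isHomogeneous e h
  have hprod : ((h - t) * (h + t)).IsHomogeneous d := by
    have : (h - t) * (h + t) = h * h - t * t := by ring
    rw [this]
    exact hd.sub (hdeg ▸ htop.mul htop)
  by_cases hz : (h - t) * (h + t) = 0
  · rcases mul_eq_zero.mp hz with h1 | h1
    · rwa [sub_eq_zero.mp h1]
    · rw [eq_neg_of_add_eq_zero_left h1]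
      exact htop.neg
  · exfalso
    obtain ⟨h1, h2⟩ := mul_ne_zero_iff.mp hz
    have htot := hprod.totalDegree hz
    rw [totalDegree_mul_of_isDomain h1 h2] at htot
    have hle : (h + t).totalDegree ≤ e :=
      (totalDegree_add _ _).trans (max_le le_rfl htop.totalDegree_le)
    obtain ⟨s, hs, hs'⟩ := (h - t).support.exists_mem_eq_sup
      (support_nonempty.mpr h1) fun s => s.sum fun _ k => k
    have hse : s.degree = e := by
      have h3 : (h - t).totalDegree = s.sum fun _ k => k := hs'
      have h4 : (h - t).totalDegree ≤ e :=
        (totalDegree_sub _ _).trans (max_le le_rfl htop.totalDegree_le)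
      have h5 : (s.sum fun _ k => k) = s.degree := rfl
      omega
    rw [MvPolynomial.mem_support_iff] at hs
    apply hs
    rw [coeff_sub, ht, coeff_homogeneousComponent, if_pos hse, sub_self]

open MvPolynomial in
theorem isHomogeneous_of_X_mul {R σ : Type*} [CommRing R] {g : MvPolynomial σ R} {p : σ}
    {d : ℕ} (h : (X p * g).IsHomogeneous d) : g.IsHomogeneous (d - 1) := by
  intro s hs
  have h1 : coeff (Finsupp.single p 1 + s) (X p * g) ≠ 0 := by
    rwa [coeff_X_mul]
  have h2 := h h1
  rw [map_add] at h2
  simp only [Finsupp.weight_single] at h2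
  simp at h2
  omega

open MvPolynomial in
/-- The determinant of a matrix of linear forms is homogeneous. -/
theorem isHomogeneous_det {R σ ι : Type*} [CommRing R] [Fintype ι] [DecidableEq ι]
    {M : Matrix ι ι (MvPolynomial σ R)} (hM : ∀ i j, (M i j).IsHomogeneous 1) :
    M.det.IsHomogeneous (Fintype.card ι) := by
  rw [Matrix.det_apply]
  refine IsHomogeneous.sum _ _ _ fun τ _ => ?_
  have h1 : (∏ i, M (τ i) i).IsHomogeneous (Fintype.card ι) := by
    simpa using IsHomogeneous.prod Finset.univ (fun i => M (τ i) i) (fun _ => 1)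
      fun i _ => hM _ _
  rcases Int.units_eq_one_or (Equiv.Perm.sign τ) with h | h
  · simpa [h] using h1
  · simpa [h] using h1.neg

/-- In an integrally closed domain, an element whose image in the fraction field becomes a square
after multiplication by a nonzero square is itself a square. -/
theorem isSquare_of_isSquare_mul_sq {R : Type*} [CommRing R] [IsDomain R] [IsIntegrallyClosed R]
    {f x : R} (hx : x ≠ 0) (h : IsSquare (algebraMap R (FractionRing R) (f * x ^ 2))) :
    IsSquare f := by
  obtain ⟨s, hs⟩ := h
  have hx' : algebraMap R (FractionRing R) x ≠ 0 := by
    simpa using hx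
  have hsq : (s / algebraMap R (FractionRing R) x) ^ 2 = algebraMap R (FractionRing R) f := by
    rw [map_mul, map_pow] at hs
    rw [div_pow, div_eq_iff (pow_ne_zero 2 hx'), hs, sq]
  obtain ⟨g, hg⟩ := IsIntegrallyClosed.exists_algebraMap_eq_of_isIntegral_pow (R := R)
    (x := s / algebraMap R (FractionRing R) x) two_pos (by
      rw [hsq]
      exact isIntegral_algebraMap)
  refine ⟨g, IsFractionRing.injective R (FractionRing R) ?_⟩
  rw [map_mul, hg, ← sq, hsq]

open MvPolynomial in
/-- If the adjugate of `M` has a nonzero principal entry and `M` annihilates the vector of variables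
on both sides, then the diagonal of the adjugate is a multiple of the squares of the variables. -/
theorem exists_adjugate_diag_eq {K σ : Type*} [Field K] [Fintype σ] [DecidableEq σ]
    [Nontrivial σ] {M : Matrix σ σ (MvPolynomial σ K)} (hX : M.mulVec X = 0)
    (hX' : Matrix.vecMul X M = 0) {p : σ} (hp : M.adjugate p p ≠ 0) :
    ∃ f, ∀ i, M.adjugate i i = f * X i ^ 2 := by
  have hX0 : ∀ i : σ, (X i : MvPolynomial σ K) ≠ 0 := fun i => X_ne_zero i
  have hdet : M.det = 0 :=
    Matrix.exists_mulVec_eq_zero_iff.mp ⟨X, fun h => hX0 p (congrFun h p), hX⟩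
  have hcol : ∀ i j, X p * M.adjugate i j = M.adjugate p j * X i := fun i j =>
    mul_eq_mul_of_mulVec_eq_zero hp hX (w := fun i => M.adjugate i j) (by
      have := M.mul_adjugate
      rw [hdet, zero_smul] at this
      ext1 k
      exact congrFun (congrFun this k) j) i
  have hrow : ∀ i j, X p * M.adjugate i j = M.adjugate i p * X j := fun i j =>
    mul_eq_mul_of_mulVec_eq_zero (M := M.transpose) (p := p) (q := p)
      (by rwa [← Matrix.adjugate_transpose]) (by rwa [Matrix.mulVec_transpose])
      (w := fun j => M.adjugate i j) (by
        have := M.adjugate_mul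
        rw [hdet, zero_smul] at this
        rw [Matrix.mulVec_transpose]
        ext1 k
        exact congrFun (congrFun this i) k) j
  obtain ⟨r, hr⟩ := exists_ne p
  have hdvd : ∀ j, (X p : MvPolynomial σ K) ∣ M.adjugate p j := fun j =>
    ((X_prime (i := p)).dvd_or_dvd ⟨_, (hcol r j).symm⟩).resolve_right
      (by rw [X_dvd_X]; exact hr.symm)
  choose b hb using hdvd
  have hcol' : ∀ i j, M.adjugate i j = X i * b j := fun i j =>
    mul_left_cancel₀ (hX0 p) (by rw [hcol, hb]; ring)
  have hb' : ∀ j, X p * b j = b p * X j := fun j =>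
    mul_left_cancel₀ (hX0 p) (by
      have := hrow p j
      rw [hcol', hcol' p p] at this
      rw [this]; ring)
  obtain ⟨f, hf⟩ : (X p : MvPolynomial σ K) ∣ b p :=
    ((X_prime (i := p)).dvd_or_dvd ⟨_, (hb' r).symm⟩).resolve_right
      (by rw [X_dvd_X]; exact hr.symm)
  refine ⟨f, fun i => ?_⟩
  rw [hcol', mul_left_cancel₀ (hX0 p) ((hb' i).trans (by rw [hf, mul_assoc]))]
  ring

section TrilinSwap

variable {K V : Type*} [Field K] [AddCommGroup V] [Module K V]
  (χ : AlternatingMap K V K (Fin 3))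

theorem trilin_swap_fst_snd (u v w : V) : χ ![u, v, w] = -χ ![v, u, w] := by
  rw [← χ.map_swap ![v, u, w] (i := 0) (j := 1) (by decide)]
  congr 1
  funext i; fin_cases i <;> simp [Equiv.swap_apply_of_ne_of_ne]

theorem trilin_swap_snd_thd (u v w : V) : χ ![u, v, w] = -χ ![u, w, v] := by
  rw [← χ.map_swap ![u, w, v] (i := 1) (j := 2) (by decide)]
  congr 1
  funext i; fin_cases i <;> simp [Equiv.swap_apply_of_ne_of_ne]

theorem trilin_self_snd_thd (u v : V) : χ ![u, v, v] = 0 :=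
  χ.map_eq_zero_of_eq _ (i := 1) (j := 2) (by simp) (by decide)

end TrilinSwap

/-- The Gram matrix of the alternating bilinear form `χ(u, ·, ·)`, as a matrix of linear forms
in the coordinates of `u`. -/
noncomputable def trilinMatrix {K ι : Type*} [Field K] [Fintype ι] [DecidableEq ι]
    (χ : AlternatingMap K (ι → K) K (Fin 3)) : Matrix ι ι (MvPolynomial ι K) :=
  Matrix.of fun i j => ∑ k, MvPolynomial.C
    (χ ![Pi.single k 1, Pi.single i 1, Pi.single j 1]) * MvPolynomial.X k

section TrilinMatrix

variable {K ι : Type*} [Field K] [Fintype ι] [DecidableEq ι]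
  (χ : AlternatingMap K (ι → K) K (Fin 3))

theorem trilin_eq_sum_fst (u v w : ι → K) :
    χ ![u, v, w] = ∑ k, u k * χ ![Pi.single k 1, v, w] := by
  have h := (χ.toMultilinearMap.toLinearMap ![u, v, w] 0).pi_apply_eq_sum_univ u
  simp only [MultilinearMap.toLinearMap_apply, AlternatingMap.coe_multilinearMap] at h
  have hu : ∀ x, Function.update ![u, v, w] 0 x = ![x, v, w] := by
    intro x; funext i; fin_cases i <;> simp
  simp only [hu] at h
  rw [h]
  refine Finset.sum_congr rfl fun k _ => ?_
  rw [smul_eq_mul]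
  congr 3
  ext j
  simp [Pi.single_apply, eq_comm]

theorem trilinMatrix_diag (i : ι) : trilinMatrix χ i i = 0 := by
  simp [trilinMatrix, trilin_self_snd_thd]

theorem trilinMatrix_anti (i j : ι) : trilinMatrix χ i j = -trilinMatrix χ j i := by
  simp only [trilinMatrix, Matrix.of_apply, ← Finset.sum_neg_distrib]
  refine Finset.sum_congr rfl fun k _ => ?_
  rw [trilin_swap_snd_thd, map_neg, neg_mul]

theorem isHomogeneous_trilinMatrix (i j : ι) : (trilinMatrix χ i j).IsHomogeneous 1 :=
  MvPolynomial.IsHomogeneous.sum _ _ _ fun k _ => MvPolynomial.isHomogeneous_C_mul_X _ k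

theorem eval_trilinMatrix (u : ι → K) (i j : ι) :
    MvPolynomial.eval u (trilinMatrix χ i j) = χ ![u, Pi.single i 1, Pi.single j 1] := by
  rw [trilin_eq_sum_fst]
  simp [trilinMatrix, mul_comm]

theorem trilinMatrix_mulVec_X : (trilinMatrix χ).mulVec MvPolynomial.X = 0 := by
  ext1 i
  simp only [Matrix.mulVec, dotProduct, trilinMatrix, Matrix.of_apply, Finset.sum_mul,
    Pi.zero_apply]
  rw [← Finset.sum_product']
  refine Finset.sum_involution (fun x _ => (x.2, x.1)) ?_ ?_ (by simp) (by simp)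
  · rintro ⟨j, k⟩ -
    have : χ ![Pi.single k 1, Pi.single i 1, Pi.single j 1]
        = -χ ![Pi.single j 1, Pi.single i 1, Pi.single k 1] := by
      rw [trilin_swap_fst_snd, trilin_swap_snd_thd, trilin_swap_fst_snd χ _ (Pi.single j 1),
        neg_neg]
    simp only [this, map_neg]
    ring
  · rintro ⟨j, k⟩ - hne heq
    obtain rfl : k = j := congrArg Prod.fst heq
    exact hne (by
      simp [trilin_swap_fst_snd χ (Pi.single k 1) (Pi.single i 1), trilin_self_snd_thd])

theorem X_vecMul_trilinMatrix : Matrix.vecMul MvPolynomial.X (trilinMatrix χ) = 0 := by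
  have h : (trilinMatrix χ).transpose = -trilinMatrix χ := by
    ext1 i j
    exact trilinMatrix_anti χ j i
  rw [← Matrix.mulVec_transpose, h, Matrix.neg_mulVec, trilinMatrix_mulVec_X, neg_zero]

theorem trilinRad_eq_ker (u : ι → K) :
    trilinRad χ u
      = LinearMap.ker ((MvPolynomial.eval u).mapMatrix (trilinMatrix χ)).mulVecLin := by
  have hmul : ∀ v i, ((MvPolynomial.eval u).mapMatrix (trilinMatrix χ)).mulVec v i
      = -χ ![u, v, Pi.single i 1] := by
    intro v i
    rw [trilin_swap_fst_snd, trilin_eq_sum_fst]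
    simp only [Matrix.mulVec, dotProduct, RingHom.mapMatrix_apply, Matrix.map_apply,
      eval_trilinMatrix, neg_neg]
    refine Finset.sum_congr rfl fun j _ => ?_
    rw [trilin_swap_snd_thd, trilin_swap_fst_snd, neg_neg, mul_comm]
  ext v
  rw [LinearMap.mem_ker, Matrix.mulVecLin_apply, funext_iff]
  constructor
  · intro h i
    rw [hmul, h, neg_zero, Pi.zero_apply]
  · intro h w
    rw [trilin_swap_snd_thd, trilin_swap_fst_snd, neg_neg, trilin_eq_sum_fst]
    refine Finset.sum_eq_zero fun i _ => ?_
    have := h i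
    rw [hmul, Pi.zero_apply, trilin_swap_snd_thd, trilin_swap_fst_snd, neg_neg, neg_eq_zero] at this
    rw [this, mul_zero]

/-- For `u p ≠ 0`, the vector `u` is a pole iff the `p`-th principal cofactor vanishes at `u`. -/
theorem pole_iff_eval_adjugate_eq_zero {u : ι → K} {p : ι} (hp : u p ≠ 0) :
    2 ≤ finrank K (trilinRad χ u)
      ↔ MvPolynomial.eval u ((trilinMatrix χ).adjugate p p) = 0 := by
  have hX : (fun i => MvPolynomial.eval u (MvPolynomial.X i : MvPolynomial ι K)) = u := by
    ext i
    simp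
  have h1 : ((MvPolynomial.eval u).mapMatrix (trilinMatrix χ)).mulVec u = 0 := by
    ext i
    have h := (MvPolynomial.eval u).map_mulVec (trilinMatrix χ) MvPolynomial.X i
    rw [trilinMatrix_mulVec_X, Pi.zero_apply, map_zero] at h
    simpa [Function.comp_def] using h.symm
  have h2 : Matrix.vecMul u ((MvPolynomial.eval u).mapMatrix (trilinMatrix χ)) = 0 := by
    ext i
    have h := (MvPolynomial.eval u).map_vecMul (trilinMatrix χ) MvPolynomial.X i
    rw [X_vecMul_trilinMatrix, Pi.zero_apply, map_zero] at h
    simpa [Function.comp_def] using h.symm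
  have h3 := (finrank_ker_le_one_iff_adjugate_ne_zero h1 h2 hp).not
  rw [← trilinRad_eq_ker, not_le, not_not, ← RingHom.map_adjugate, RingHom.mapMatrix_apply,
    Matrix.map_apply] at h3
  exact h3

end TrilinMatrix

/-- for odd `n ≥ 3` and a nonzero alternating trilinear form `χ` on `K^n`,
if not every nonzero vector is a pole then the set of poles is cut out by a nonzero
homogeneous polynomial of degree at most `(n-3)/2`. -/
theorem stmt2 (K : Type*) [Field K] (n : ℕ) (hodd : Odd n) (hn : 3 ≤ n)
    (χ : AlternatingMap K (Fin n → K) K (Fin 3)) (hχ : χ ≠ 0)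
    (h : ∃ u : Fin n → K, u ≠ 0 ∧ ¬ 2 ≤ Module.finrank K (trilinRad χ u)) :
    ∃ (g : MvPolynomial (Fin n) K) (d : ℕ), g ≠ 0 ∧ d ≤ (n - 3) / 2 ∧
      g.IsHomogeneous d ∧
      ∀ u : Fin n → K, u ≠ 0 →
        (2 ≤ Module.finrank K (trilinRad χ u) ↔ MvPolynomial.eval u g = 0) := by
  classical
  obtain ⟨m, rfl⟩ : ∃ m, n = m + 1 := ⟨n - 1, by omega⟩
  have : Nontrivial (Fin (m + 1)) := Fin.nontrivial_iff_two_le.mpr (by omega)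
  obtain ⟨u₀, hu₀, hpole⟩ := h
  obtain ⟨p, hp⟩ := Function.ne_iff.mp hu₀
  rw [pole_iff_eval_adjugate_eq_zero χ hp] at hpole
  have hadj : (trilinMatrix χ).adjugate p p ≠ 0 := by
    intro h0
    exact hpole (by rw [h0, map_zero])
  obtain ⟨f, hf⟩ := exists_adjugate_diag_eq (trilinMatrix_mulVec_X χ)
    (X_vecMul_trilinMatrix χ) hadj
  have hminor : (trilinMatrix χ).adjugate p p
      = ((trilinMatrix χ).submatrix p.succAbove p.succAbove).det := by
    rw [Matrix.adjugate_fin_succ_eq_det_submatrix, (Even.add_self _).neg_one_pow, one_mul]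
  have hsquare : IsSquare f := by
    refine isSquare_of_isSquare_mul_sq (MvPolynomial.X_ne_zero p) ?_
    rw [← hf, hminor, RingHom.map_det]
    refine isSquare_det_of_alternating _ (fun i => ?_) fun i j => ?_
    · simp [trilinMatrix_diag]
    · simp [trilinMatrix_anti χ (p.succAbove i)]
  obtain ⟨g, rfl⟩ := hsquare
  have hg : g ≠ 0 := by
    rintro rfl
    exact hadj (by rw [hf]; simp)
  have hXg : MvPolynomial.X p * g ≠ 0 := mul_ne_zero (MvPolynomial.X_ne_zero p) hg
  have hhom : (MvPolynomial.X p * g * (MvPolynomial.X p * g)).IsHomogeneous m := by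
    have h1 : MvPolynomial.X p * g * (MvPolynomial.X p * g)
        = (trilinMatrix χ).adjugate p p := by
      rw [hf]; ring
    rw [h1, hminor]
    simpa using isHomogeneous_det (M := (trilinMatrix χ).submatrix p.succAbove p.succAbove)
      fun i j => isHomogeneous_trilinMatrix χ _ _
  have hdeg := hhom.totalDegree (mul_ne_zero hXg hXg)
  rw [MvPolynomial.totalDegree_mul_of_isDomain hXg hXg] at hdeg
  refine ⟨g, _, hg, ?_, isHomogeneous_of_X_mul (isHomogeneous_of_mul_self hhom), ?_⟩
  · omega
  · intro u hu
    obtain ⟨q, hq⟩ := Function.ne_iff.mp hu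
    rw [Pi.zero_apply] at hq
    rw [pole_iff_eval_adjugate_eq_zero χ hq, hf]
    simp [hq]
end

section
/- Let K be a field and let n ≥ 5 be an odd natural number. Then there exist a nonzero alternating trilinear form χ on V = K^n and nonzero linear functionals f_1, …, f_{(n−3)/2} on V, pairwise non-proportional (so that their kernels are (n−3)/2 distinct hyperplanes of the projective space of V), such that a nonzero u ∈ V is a pole of χ if and only if f_i(u) = 0 for some 1 ≤ i ≤ (n−3)/2. -/
open Module

/-- A vector `v` outside the line `K u` that lies in the radical of `u`. -/
def HasPoleAt {K V : Type*} [Field K] [AddCommGroup V] [Module K V]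
    (χ : AlternatingMap K V K (Fin 3)) (u : V) : Prop :=
  ∃ v : V, (∀ c : K, v ≠ c • u) ∧ ∀ x, χ ![u, v, x] = 0

theorem two_le_finrank_trilinRad_iff {K V : Type*} [Field K] [AddCommGroup V] [Module K V]
    [FiniteDimensional K V] (χ : AlternatingMap K V K (Fin 3)) {u : V} (hu : u ≠ 0) :
    2 ≤ finrank K (trilinRad χ u) ↔ HasPoleAt χ u := by
  have huR : u ∈ trilinRad χ u := fun x =>
    χ.map_eq_zero_of_eq ![u, u, x] (i := 0) (j := 1) (by simp) (by decide)
  constructor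
  · intro h
    by_contra hno
    have hall : ∀ v ∈ trilinRad χ u, ∃ c : K, c • u = v := by
      intro v hv
      by_contra! hc
      exact hno ⟨v, fun c => (hc c).symm, hv⟩
    have hle : finrank K (trilinRad χ u) ≤ 1 :=
      finrank_le_one (⟨u, huR⟩ : trilinRad χ u) fun w => by
        obtain ⟨c, hc⟩ := hall w w.2
        exact ⟨c, Subtype.ext hc⟩
    omega
  · rintro ⟨v, hv, hx⟩
    have hli : LinearIndependent K ![(⟨u, huR⟩ : trilinRad χ u), ⟨v, hx⟩] := by
      rw [LinearIndependent.pair_iff' (by simpa [Subtype.ext_iff] using hu)]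
      intro c hc
      exact hv c (congrArg Subtype.val hc).symm
    simpa using hli.fintype_card_le_finrank

/-- The set of poles of `χ` is the union of the kernels of the functionals `f i`. -/
def PolesAreKernels {K V : Type*} [Field K] [AddCommGroup V] [Module K V] {m : ℕ}
    (χ : AlternatingMap K V K (Fin 3)) (f : Fin m → V →ₗ[K] K) : Prop :=
  ∀ u, u ≠ 0 → (HasPoleAt χ u ↔ ∃ i, f i u = 0)

theorem hasPoleAt_compLinearMap_equiv {K V W : Type*} [Field K] [AddCommGroup V] [Module K V]
    [AddCommGroup W] [Module K W] (χ : AlternatingMap K V K (Fin 3)) (e : W ≃ₗ[K] V) (u : W) :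
    HasPoleAt (χ.compLinearMap e.toLinearMap) u ↔ HasPoleAt χ (e u) := by
  have key : ∀ v x : W, χ.compLinearMap e.toLinearMap ![u, v, x] = χ ![e u, e v, e x] := by
    intro v x
    rw [AlternatingMap.compLinearMap_apply]
    congr 1
    funext i; fin_cases i <;> rfl
  constructor
  · rintro ⟨v, hv, hx⟩
    refine ⟨e v, fun c hc => hv c (e.injective (by simpa using hc)), fun x => ?_⟩
    simpa [key] using hx (e.symm x)
  · rintro ⟨v, hv, hx⟩
    refine ⟨e.symm v, fun c hc => hv c (by rw [← map_smul, ← hc]; simp), fun x => ?_⟩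
    rw [key]
    simpa using hx (e x)

theorem detRowAlternating_fin_three_apply {K : Type*} [Field K] (w : Fin 3 → Fin 3 → K) :
    (Matrix.detRowAlternating : AlternatingMap K (Fin 3 → K) K (Fin 3)) w =
      w 0 0 * w 1 1 * w 2 2 - w 0 0 * w 1 2 * w 2 1 - w 0 1 * w 1 0 * w 2 2
        + w 0 1 * w 1 2 * w 2 0 + w 0 2 * w 1 0 * w 2 1 - w 0 2 * w 1 1 * w 2 0 :=
  Matrix.det_fin_three (Matrix.of w)

theorem polesAreKernels_detRowAlternating (K : Type*) [Field K]
    (f : Fin 0 → (Fin 3 → K) →ₗ[K] K) :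
    PolesAreKernels (Matrix.detRowAlternating : AlternatingMap K (Fin 3 → K) K (Fin 3)) f := by
  intro u hu
  refine ⟨?_, fun ⟨i, _⟩ => i.elim0⟩
  rintro ⟨v, hv, hx⟩
  exfalso
  have h0 := hx (Pi.single 0 1)
  have h1 := hx (Pi.single 1 1)
  have h2 := hx (Pi.single 2 1)
  simp [detRowAlternating_fin_three_apply] at h0 h1 h2
  obtain ⟨i, hi⟩ := Function.ne_iff.mp hu
  refine hv (v i / u i) ?_
  funext j
  simp only [Pi.smul_apply, smul_eq_mul, Pi.zero_apply] at hi ⊢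
  field_simp
  fin_cases i <;> fin_cases j <;> simp <;> grind

/-- The form `χ + ℓ ∧ a ∧ b` on `V × K × K`, where `a` and `b` are the two new coordinates. -/
noncomputable def extendForm {K V : Type*} [Field K] [AddCommGroup V] [Module K V]
    (χ : AlternatingMap K V K (Fin 3)) (l : V →ₗ[K] K) :
    AlternatingMap K (V × K × K) K (Fin 3) :=
  χ.compLinearMap (LinearMap.fst K V (K × K)) +
    (Matrix.detRowAlternating : AlternatingMap K (Fin 3 → K) K (Fin 3)).compLinearMap
      (LinearMap.pi ![l ∘ₗ LinearMap.fst K V (K × K),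
        LinearMap.fst K K K ∘ₗ LinearMap.snd K V (K × K),
        LinearMap.snd K K K ∘ₗ LinearMap.snd K V (K × K)])

theorem extendForm_apply {K V : Type*} [Field K] [AddCommGroup V] [Module K V]
    (χ : AlternatingMap K V K (Fin 3)) (l : V →ₗ[K] K) (u v x : V × K × K) :
    extendForm χ l ![u, v, x] = χ ![u.1, v.1, x.1] +
      (l x.1 * (u.2.1 * v.2.2 - u.2.2 * v.2.1) - x.2.1 * (l u.1 * v.2.2 - u.2.2 * l v.1)
        + x.2.2 * (l u.1 * v.2.1 - u.2.1 * l v.1)) := by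
  rw [extendForm, AlternatingMap.add_apply, AlternatingMap.compLinearMap_apply,
    AlternatingMap.compLinearMap_apply]
  congr 1
  · congr 1
    funext i; fin_cases i <;> rfl
  · rw [detRowAlternating_fin_three_apply]
    simp
    ring

theorem extendForm_rad_iff {K V : Type*} [Field K] [AddCommGroup V] [Module K V]
    (χ : AlternatingMap K V K (Fin 3)) (l : V →ₗ[K] K) (u v : V × K × K) :
    (∀ x, extendForm χ l ![u, v, x] = 0) ↔
      (∀ y, χ ![u.1, v.1, y] + l y * (u.2.1 * v.2.2 - u.2.2 * v.2.1) = 0) ∧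
        l u.1 * v.2.2 = u.2.2 * l v.1 ∧ l u.1 * v.2.1 = u.2.1 * l v.1 := by
  have hz : χ ![u.1, v.1, 0] = 0 := AlternatingMap.map_coord_zero χ 2 (by simp)
  constructor
  · intro h
    refine ⟨fun y => ?_, ?_, ?_⟩
    · simpa [extendForm_apply] using h (y, 0, 0)
    · have := h (0, 1, 0)
      simp [extendForm_apply, hz] at this
      linear_combination -this
    · have := h (0, 0, 1)
      simp [extendForm_apply, hz] at this
      linear_combination this
  · rintro ⟨h1, h2, h3⟩ x
    rw [extendForm_apply]
    linear_combination h1 x.1 - x.2.1 * h2 + x.2.2 * h3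

theorem PolesAreKernels.extendForm {K V : Type*} [Field K] [AddCommGroup V] [Module K V]
    [FiniteDimensional K V] {m : ℕ} {χ : AlternatingMap K V K (Fin 3)} {f : Fin m → V →ₗ[K] K}
    (h : PolesAreKernels χ f) (l : V →ₗ[K] K) (hV : 2 ≤ finrank K V) :
    PolesAreKernels (extendForm χ l)
      (fun i => (Fin.cons l f : Fin (m + 1) → V →ₗ[K] K) i ∘ₗ LinearMap.fst K V (K × K)) := by
  rintro ⟨u, a, b⟩ hu
  simp only [HasPoleAt, extendForm_rad_iff, Fin.exists_fin_succ, Fin.cons_zero, Fin.cons_succ,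
    LinearMap.comp_apply, LinearMap.fst_apply]
  constructor
  · rintro ⟨⟨v, c, d⟩, hv, h1, h2, h3⟩
    by_contra! hne
    obtain ⟨hl, hf⟩ := hne
    have hu0 : u ≠ 0 := by rintro rfl; simp at hl
    simp only at h1 h2 h3
    have hs : a * d - b * c = 0 := by
      have : l u * (a * d - b * c) = 0 := by linear_combination a * h2 - b * h3
      exact (mul_eq_zero.mp this).resolve_left hl
    have hno : ¬ HasPoleAt χ u := fun hp => by
      obtain ⟨i, hi⟩ := (h u hu0).1 hp
      exact hf i hi
    have hex : ∃ t : K, v = t • u := by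
      by_contra! ht
      exact hno ⟨v, ht, fun y => by simpa [hs] using h1 y⟩
    obtain ⟨t, rfl⟩ := hex
    refine hv t ?_
    simp only [map_smul, smul_eq_mul] at h2 h3
    have hc : c = t * a := mul_left_cancel₀ hl (by linear_combination h3)
    have hd : d = t * b := mul_left_cancel₀ hl (by linear_combination h2)
    simp [hc, hd]
  · intro hk
    by_cases hl : l u = 0
    · by_cases hu0 : u = 0
      · subst hu0
        have hker : 0 < finrank K (LinearMap.ker l) := by
          have h1 := l.finrank_range_add_finrank_ker
          have h2 := (LinearMap.range l).finrank_le
          rw [finrank_self] at h2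
          omega
        obtain ⟨w, hw⟩ := (finrank_pos_iff_exists_ne_zero (R := K)).1 hker
        refine ⟨(w, 0, 0), fun c hc => hw ?_, fun y => ?_, ?_, ?_⟩
        · simpa using congrArg Prod.fst hc
        · simpa using AlternatingMap.map_coord_zero χ (m := ![0, (w : V), y]) 0 (by simp)
        · simp
        · simp
      · have hzero : ∀ y, χ ![u, 0, y] = 0 := fun y =>
          AlternatingMap.map_coord_zero χ 1 (by simp)
        by_cases hab : a = 0 ∧ b = 0
        · obtain ⟨rfl, rfl⟩ := hab
          exact ⟨(0, 1, 0), fun c hc => by simpa using congrArg (fun p => p.2.1) hc,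
            fun y => by simp [hzero], by simp, by simp [hl]⟩
        · refine ⟨(0, a, b), fun c hc => hab ?_, fun y => by simp [hzero, mul_comm],
            by simp [hl], by simp [hl]⟩
          simp only [Prod.smul_mk, Prod.mk.injEq] at hc
          have hc0 : c = 0 := (smul_eq_zero.1 hc.1.symm).resolve_right hu0
          simpa [hc0] using hc.2
    · have hu0 : u ≠ 0 := by rintro rfl; simp at hl
      obtain ⟨v, hv, hx⟩ := (h u hu0).2 (hk.resolve_left hl)
      refine ⟨(v, l v / l u * a, l v / l u * b), fun c hc => hv c (congrArg Prod.fst hc),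
        fun y => ?_, ?_, ?_⟩
      · simp only [hx y]
        ring
      · field_simp
      · field_simp

theorem exists_polesAreKernels (K : Type*) [Field K] (m : ℕ) :
    ∃ (χ : AlternatingMap K (Fin (2 * m + 3) → K) K (Fin 3))
      (f : Fin m → (Fin (2 * m + 3) → K) →ₗ[K] K),
      χ ≠ 0 ∧ LinearIndependent K f ∧ PolesAreKernels χ f := by
  induction m with
  | zero =>
    refine ⟨Matrix.detRowAlternating, Fin.elim0, ?_, linearIndependent_empty_type,
      polesAreKernels_detRowAlternating K _⟩
    intro h
    have h1 : Matrix.det (1 : Matrix (Fin 3) (Fin 3) K) = 0 := DFunLike.congr_fun h _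
    simp at h1
  | succ m ih =>
    obtain ⟨χ, f, hχ, hf, hp⟩ := ih
    obtain ⟨l, hl⟩ := exists_linearIndependent_cons_of_lt_finrank hf
      (by rw [Subspace.dual_finrank_eq, finrank_fin_fun]; omega)
    have hp' := hp.extendForm l (by simp)
    let e : (Fin (2 * (m + 1) + 3) → K) ≃ₗ[K] (Fin (2 * m + 3) → K) × K × K :=
      LinearEquiv.ofFinrankEq _ _ (by simp; ring)
    refine ⟨(extendForm χ l).compLinearMap e.toLinearMap,
      fun i => (Fin.cons l f : Fin (m + 1) → _) i ∘ₗ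
        (LinearMap.fst K _ (K × K) ∘ₗ e.toLinearMap), ?_, ?_, ?_⟩
    · contrapose! hχ
      ext w
      have hw : w = ![w 0, w 1, w 2] := by funext i; fin_cases i <;> rfl
      have h1 := DFunLike.congr_fun hχ (fun i => e.symm (w i, 0, 0))
      rw [AlternatingMap.compLinearMap_apply] at h1
      have h2 : (fun i => e.toLinearMap (e.symm (w i, 0, 0))) =
          ![(w 0, 0, 0), (w 1, 0, 0), (w 2, 0, 0)] := by
        funext i; fin_cases i <;> simp
      rw [h2, extendForm_apply] at h1
      rw [hw]
      simpa using h1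
    · have hsurj : Function.Surjective (LinearMap.fst K (Fin (2 * m + 3) → K) (K × K) ∘ₗ
          e.toLinearMap) := (LinearMap.fst_surjective (R := K) (M := Fin (2 * m + 3) → K) (M₂ := K × K)).comp
          e.surjective
      exact hl.map' (LinearMap.lcomp K K _)
        (LinearMap.ker_eq_bot.2 (LinearMap.lcomp_injective_of_surjective _ hsurj))
    · intro u hu
      rw [hasPoleAt_compLinearMap_equiv]
      exact hp' (e u) (by simpa using hu)

/-- for odd `n ≥ 5` there is a nonzero alternating trilinear form on `K^n`
whose set of poles is the union of `(n-3)/2` distinct hyperplanes, i.e. the union of the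
kernels of `(n-3)/2` pairwise non-proportional nonzero linear functionals. -/
theorem stmt4 (K : Type*) [Field K] (n : ℕ) (hodd : Odd n) (hn : 5 ≤ n) :
    ∃ (χ : AlternatingMap K (Fin n → K) K (Fin 3))
      (f : Fin ((n - 3) / 2) → ((Fin n → K) →ₗ[K] K)),
      χ ≠ 0 ∧ (∀ i, f i ≠ 0) ∧
      (∀ i j, i ≠ j → ∀ c : K, f j ≠ c • f i) ∧
      (∀ u : Fin n → K, u ≠ 0 →
        (2 ≤ Module.finrank K (trilinRad χ u) ↔ ∃ i, f i u = 0)) := by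
  obtain ⟨m, rfl⟩ : ∃ m, n = 2 * m + 3 := by
    obtain ⟨k, rfl⟩ := hodd
    exact ⟨k - 1, by omega⟩
  have hm : (2 * m + 3 - 3) / 2 = m := by omega
  rw [hm]
  obtain ⟨χ, f, hχ, hf, hp⟩ := exists_polesAreKernels K m
  refine ⟨χ, f, hχ, hf.ne_zero, fun i j hij c hc => ?_, fun u hu => ?_⟩
  · have h1 : Finsupp.single j (1 : K) = Finsupp.single i c := hf (by simp [hc])
    have h2 := DFunLike.congr_fun h1 j
    simp [hij] at h2
  · rw [two_le_finrank_trilinRad_iff χ hu]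
    exact hp u hu
end

section
/- Let K be a field and let V₀, V₁ be finite-dimensional K-vector spaces of dimensions n₀ ≥ 3 and n₁ ≥ 3. Let χ₀, χ₁ be nonzero alternating trilinear forms on V₀ and V₁ respectively, and define the alternating trilinear form χ on V := V₀ × V₁ by χ((x₀,x₁), (y₀,y₁), (z₀,z₁)) := χ₀(x₀, y₀, z₀) + χ₁(x₁, y₁, z₁). Then every nonzero u ∈ V is a pole of χ, i.e., dim Rad_χ(u) ≥ 2. -/
open Module

/-- The block decomposable alternating trilinear form on `V₀ × V₁` defined by
`χ((x₀,x₁),(y₀,y₁),(z₀,z₁)) = χ₀(x₀,y₀,z₀) + χ₁(x₁,y₁,z₁)`. -/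
noncomputable def blockForm {K V₀ V₁ : Type*} [Field K]
    [AddCommGroup V₀] [Module K V₀] [AddCommGroup V₁] [Module K V₁]
    (χ₀ : AlternatingMap K V₀ K (Fin 3)) (χ₁ : AlternatingMap K V₁ K (Fin 3)) :
    AlternatingMap K (V₀ × V₁) K (Fin 3) :=
  χ₀.compLinearMap (LinearMap.fst K V₀ V₁) + χ₁.compLinearMap (LinearMap.snd K V₀ V₁)

/-- A nontrivial space contains a nonzero vector in the radical of each of its vectors. -/
theorem exists_ne_zero_mem_trilinRad {K V : Type*} [Field K] [AddCommGroup V] [Module K V]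
    [Nontrivial V] (χ : AlternatingMap K V K (Fin 3)) (u : V) :
    ∃ v ∈ trilinRad χ u, v ≠ 0 := by
  by_cases hu : u = 0
  · obtain ⟨v, hv⟩ := exists_ne (0 : V)
    exact ⟨v, fun x => χ.map_coord_zero 0 (by simp [hu]), hv⟩
  · exact ⟨u, fun x => χ.map_eq_zero_of_eq _ (i := 0) (j := 1) (by simp) (by decide), hu⟩

theorem blockForm_apply {K V₀ V₁ : Type*} [Field K]
    [AddCommGroup V₀] [Module K V₀] [AddCommGroup V₁] [Module K V₁]
    (χ₀ : AlternatingMap K V₀ K (Fin 3)) (χ₁ : AlternatingMap K V₁ K (Fin 3))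
    (x y z : V₀ × V₁) :
    blockForm χ₀ χ₁ ![x, y, z] = χ₀ ![x.1, y.1, z.1] + χ₁ ![x.2, y.2, z.2] := by
  have h₀ : (fun i => (![x, y, z] i).1) = ![x.1, y.1, z.1] := by
    funext i; fin_cases i <;> rfl
  have h₁ : (fun i => (![x, y, z] i).2) = ![x.2, y.2, z.2] := by
    funext i; fin_cases i <;> rfl
  rw [← h₀, ← h₁]
  rfl

/-- Vectors in the radicals of the components lie in the radical of a block form. -/
theorem mem_trilinRad_blockForm {K V₀ V₁ : Type*} [Field K]
    [AddCommGroup V₀] [Module K V₀] [AddCommGroup V₁] [Module K V₁]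
    {χ₀ : AlternatingMap K V₀ K (Fin 3)} {χ₁ : AlternatingMap K V₁ K (Fin 3)}
    {u v : V₀ × V₁} (h₀ : v.1 ∈ trilinRad χ₀ u.1) (h₁ : v.2 ∈ trilinRad χ₁ u.2) :
    v ∈ trilinRad (blockForm χ₀ χ₁) u := by
  intro x
  rw [blockForm_apply, h₀ x.1, h₁ x.2, add_zero]

/-- every nonzero vector of `V₀ × V₁` is a pole of a block decomposable
form built from nonzero alternating trilinear forms on spaces of dimension `≥ 3`. -/
theorem stmt5 (K V₀ V₁ : Type*) [Field K]
    [AddCommGroup V₀] [Module K V₀] [AddCommGroup V₁] [Module K V₁]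
    [FiniteDimensional K V₀] [FiniteDimensional K V₁]
    (h₀ : 3 ≤ Module.finrank K V₀) (h₁ : 3 ≤ Module.finrank K V₁)
    (χ₀ : AlternatingMap K V₀ K (Fin 3)) (hχ₀ : χ₀ ≠ 0)
    (χ₁ : AlternatingMap K V₁ K (Fin 3)) (hχ₁ : χ₁ ≠ 0)
    (u : V₀ × V₁) (hu : u ≠ 0) :
    2 ≤ Module.finrank K (trilinRad (blockForm χ₀ χ₁) u) := by
  have : Nontrivial V₀ := Module.nontrivial_of_finrank_pos (R := K) (by omega)
  have : Nontrivial V₁ := Module.nontrivial_of_finrank_pos (R := K) (by omega)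
  obtain ⟨a, ha, ha0⟩ := exists_ne_zero_mem_trilinRad χ₀ u.1
  obtain ⟨b, hb, hb0⟩ := exists_ne_zero_mem_trilinRad χ₁ u.2
  have hli : LinearIndependent K
      ![(⟨(a, 0), mem_trilinRad_blockForm ha (zero_mem _)⟩ : trilinRad (blockForm χ₀ χ₁) u),
        ⟨(0, b), mem_trilinRad_blockForm (zero_mem _) hb⟩] := by
    rw [LinearIndependent.pair_iff]
    intro s t hst
    simpa [ha0, hb0] using congrArg Subtype.val hst
  simpa using hli.fintype_card_le_finrank
end

section
/- Let K be a field, V = K^6, and χ := [123] + [145]. Then every nonzero u ∈ V is a pole of χ, and a 2-dimensional subspace ℓ of V lies in the upper radical R↑(χ) if and only if either e_6 ∈ ℓ, or ℓ ⊆ span(e_2, e_3, e_4, e_5, e_6) and x_2·y_3 − x_3·y_2 + x_4·y_5 − x_5·y_4 = 0 for all x, y ∈ ℓ. -/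
open Module

theorem trip_apply {K : Type*} [Field K] {n : ℕ} (i j k : Fin n) (x y z : Fin n → K) :
    trip i j k ![x, y, z] =
      x i * (y j * z k - y k * z j) - x j * (y i * z k - y k * z i)
        + x k * (y i * z j - y j * z i) := by
  change (Matrix.of fun m l => ![x, y, z] m (![i, j, k] l)).det = _
  rw [Matrix.det_fin_three]
  simp
  ring

theorem two_le_finrank_of_linearIndependent_pair {K V : Type*} [Field K] [AddCommGroup V]
    [Module K V] [FiniteDimensional K V] {S : Submodule K V} {u v : V} (hu : u ∈ S) (hv : v ∈ S)
    (h : LinearIndependent K ![u, v]) : 2 ≤ finrank K S := by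
  have hspan : finrank K (Submodule.span K (Set.range ![u, v])) = 2 := finrank_span_eq_card h
  rw [← hspan]
  refine Submodule.finrank_mono (Submodule.span_le.2 ?_)
  rintro _ ⟨i, rfl⟩
  fin_cases i
  · exact hu
  · exact hv

theorem mem_trilinRad_self {K V : Type*} [Field K] [AddCommGroup V] [Module K V]
    (χ : AlternatingMap K V K (Fin 3)) (u : V) : u ∈ trilinRad χ u := fun x =>
  χ.map_eq_zero_of_eq ![u, u, x] (i := 0) (j := 1) rfl (by decide)

theorem mem_span_single_succ_iff {K : Type*} [Field K] {n : ℕ} (x : Fin (n + 1) → K) :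
    x ∈ Submodule.span K (Set.range fun i : Fin n => Pi.single (Fin.succ i) (1 : K)) ↔
      x 0 = 0 := by
  constructor
  · intro hx
    have hle : Submodule.span K (Set.range fun i : Fin n =>
        (Pi.single (Fin.succ i) (1 : K) : Fin (n + 1) → K)) ≤
        LinearMap.ker (LinearMap.proj (R := K) (φ := fun _ : Fin (n + 1) => K) 0) := by
      rw [Submodule.span_le]
      rintro _ ⟨i, rfl⟩
      simp
    exact hle hx
  · intro hx
    rw [Submodule.mem_span_range_iff_exists_fun]
    refine ⟨fun i => x i.succ, ?_⟩
    conv_rhs => rw [pi_eq_sum_univ' x, Fin.sum_univ_succ, hx, zero_smul, zero_add]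

/-- If a plane contains a standard basis vector `e`, then the projections along `e` of any two
vectors of that plane are proportional. -/
theorem mul_eq_mul_of_single_mem {K ι : Type*} [Field K] [Fintype ι] [DecidableEq ι]
    {S : Submodule K (ι → K)} (hS : finrank K S = 2) {k : ι} (hk : Pi.single k (1 : K) ∈ S)
    {x y : ι → K} (hx : x ∈ S) (hy : y ∈ S) {i j : ι} (hi : i ≠ k) (hj : j ≠ k) :
    x i * y j = x j * y i := by
  have hdep : ¬ LinearIndependent K ![(⟨x, hx⟩ : S), ⟨y, hy⟩, ⟨_, hk⟩] := fun h => by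
    have := h.fintype_card_le_finrank
    rw [hS, Fintype.card_fin] at this
    omega
  rw [Fintype.not_linearIndependent_iff] at hdep
  obtain ⟨g, hg, m, hm⟩ := hdep
  have hsum : g 0 • x + g 1 • y + g 2 • Pi.single k (1 : K) = 0 := by
    simpa [Fin.sum_univ_three] using congrArg Subtype.val hg
  have hcoord {l : ι} (hl : l ≠ k) : g 0 * x l + g 1 * y l = 0 := by
    simpa [hl] using congrFun hsum l
  have hi' := hcoord hi
  have hj' := hcoord hj
  by_cases h0 : g 0 = 0
  · by_cases h1 : g 1 = 0
    · have h2 : g 2 = 0 := by simpa [h0, h1] using congrFun hsum k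
      fin_cases m <;> contradiction
    · apply mul_left_cancel₀ h1
      linear_combination x i * hj' - x j * hi'
  · apply mul_left_cancel₀ h0
    linear_combination y j * hi' - y i * hj'

/-- for `χ = [123] + [145]` on `K^6`, every nonzero vector is a pole, and a
2-dimensional subspace `ℓ` is in the upper radical iff either `e₆ ∈ ℓ`, or
`ℓ ⊆ span(e₂,…,e₆)` and `ℓ` is totally isotropic for the symplectic form
`x₂y₃ − x₃y₂ + x₄y₅ − x₅y₄`. -/
theorem stmt9 (K : Type*) [Field K]
    (χ : AlternatingMap K (Fin 6 → K) K (Fin 3))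
    (hχ : χ = trip 0 1 2 + trip 0 3 4) :
    (∀ u : Fin 6 → K, u ≠ 0 → 2 ≤ Module.finrank K (trilinRad χ u)) ∧
    (∀ ℓ : Submodule K (Fin 6 → K), Module.finrank K ℓ = 2 →
      ((∀ u : Fin 6 → K, ∀ x ∈ ℓ, ∀ y ∈ ℓ, χ ![u, x, y] = 0) ↔
        (Pi.single (5 : Fin 6) (1 : K) ∈ ℓ ∨
          (ℓ ≤ Submodule.span K
              (Set.range fun i : Fin 5 => Pi.single (Fin.succ i) (1 : K)) ∧
            ∀ x ∈ ℓ, ∀ y ∈ ℓ,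
              x 1 * y 2 - x 2 * y 1 + x 3 * y 4 - x 4 * y 3 = 0)))) := by
  have hval (u x y : Fin 6 → K) : χ ![u, x, y] =
      u 0 * (x 1 * y 2 - x 2 * y 1 + x 3 * y 4 - x 4 * y 3)
        - u 1 * (x 0 * y 2 - x 2 * y 0) + u 2 * (x 0 * y 1 - x 1 * y 0)
        - u 3 * (x 0 * y 4 - x 4 * y 0) + u 4 * (x 0 * y 3 - x 3 * y 0) := by
    rw [hχ, AlternatingMap.add_apply, trip_apply, trip_apply]
    ring
  refine ⟨fun u hu => ?_, fun ℓ hℓ => ⟨fun h => ?_, ?_⟩⟩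
  · by_cases hu' : ∃ i : Fin 6, i ≠ 5 ∧ u i ≠ 0
    · obtain ⟨i, hi, hui⟩ := hu'
      refine two_le_finrank_of_linearIndependent_pair (mem_trilinRad_self χ u)
        (v := Pi.single 5 1) (fun x => by rw [hval]; simp) ?_
      rw [LinearIndependent.pair_iff]
      intro s t hst
      have hs : s = 0 := by simpa [hi, hui] using congrFun hst i
      exact ⟨hs, by simpa [hs] using congrFun hst 5⟩
    · push Not at hu'
      have hu5 : u 5 ≠ 0 := fun h5 => hu (funext fun i => by
        by_cases hi : i = 5
        · rw [hi, h5]; rfl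
        · exact hu' i hi)
      refine two_le_finrank_of_linearIndependent_pair (mem_trilinRad_self χ u)
        (v := Pi.single 0 1) (fun x => by
          rw [hval, hu' 0 (by decide), hu' 1 (by decide), hu' 2 (by decide),
            hu' 3 (by decide), hu' 4 (by decide)]
          ring) ?_
      rw [LinearIndependent.pair_iff]
      intro s t hst
      have hs : s = 0 := by simpa [hu5] using congrFun hst 5
      exact ⟨hs, by simpa [hs] using congrFun hst 0⟩
  · by_cases hx0 : ∀ x ∈ ℓ, x 0 = 0
    · refine Or.inr ⟨fun x hx => (mem_span_single_succ_iff x).2 (hx0 x hx), fun x hx y hy => ?_⟩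
      simpa [hval] using h (Pi.single 0 1) x hx y hy
    · push Not at hx0
      obtain ⟨x, hx, hx0⟩ := hx0
      have hnle : ¬ ℓ ≤ Submodule.span K {x} := fun hle => by
        have := (Submodule.finrank_mono hle).trans (finrank_span_le_card {x})
        simp [hℓ] at this
      obtain ⟨y, hy, hyx⟩ := SetLike.not_le_iff_exists.1 hnle
      have h1 := h (Pi.single 2 1) x hx y hy
      have h2 := h (Pi.single 1 1) x hx y hy
      have h3 := h (Pi.single 4 1) x hx y hy
      have h4 := h (Pi.single 3 1) x hx y hy
      simp [hval] at h1 h2 h3 h4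
      set c := x 0 * y 5 - x 5 * y 0 with hc
      have hcomb : x 0 • y - y 0 • x = c • Pi.single (5 : Fin 6) (1 : K) := by
        funext i
        fin_cases i <;> simp [hc]
        · ring
        · linear_combination h1
        · linear_combination -h2
        · linear_combination h3
        · linear_combination -h4
        · ring
      have hc0 : c ≠ 0 := fun hc0 => hyx <| by
        rw [hc0, zero_smul, sub_eq_zero] at hcomb
        exact Submodule.mem_span_singleton.2
          ⟨(x 0)⁻¹ * y 0, by rw [mul_smul, ← hcomb, inv_smul_smul₀ hx0]⟩
      left
      rw [← Submodule.smul_mem_iff ℓ hc0, ← hcomb]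
      exact ℓ.sub_mem (ℓ.smul_mem _ hy) (ℓ.smul_mem _ hx)
  · rintro (h5 | ⟨hle, hω⟩) u x hx y hy
    · have hminor {i j : Fin 6} (hi : i ≠ 5) (hj : j ≠ 5) : x i * y j = x j * y i :=
        mul_eq_mul_of_single_mem hℓ h5 hx hy hi hj
      rw [hval, hminor (i := 1) (j := 2) (by decide) (by decide),
        hminor (i := 3) (j := 4) (by decide) (by decide),
        hminor (i := 0) (j := 1) (by decide) (by decide),
        hminor (i := 0) (j := 2) (by decide) (by decide),
        hminor (i := 0) (j := 3) (by decide) (by decide),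
        hminor (i := 0) (j := 4) (by decide) (by decide)]
      ring
    · rw [hval, hω x hx y hy, (mem_span_single_succ_iff x).1 (hle hx),
        (mem_span_single_succ_iff y).1 (hle hy)]
      ring
end

section
/- Let K be a field, V = K^6, χ := [162] + [243] + [135], V₀ := span(e_1, e_2, e_3), V₁ := span(e_4, e_5, e_6), and let ω : V → V be the linear isomorphism ω(u_1, u_2, u_3, u_4, u_5, u_6) = (u_4, u_5, u_6, u_1, u_2, u_3) (which interchanges V₀ and V₁). Then: (i) every nonzero u ∈ V is a pole of χ, with dim Rad_χ(u) = 4 if u ∈ V₁ and dim Rad_χ(u) = 2 if u ∉ V₁; (ii) a 2-dimensional subspace ℓ of V lies in the upper radical R↑(χ) if and only if either ℓ ⊆ V₁, or ℓ = span{a + b, ω(a)} for some nonzero a ∈ V₀ and some b ∈ V₁. -/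
open Module

/-- Two vectors of `K³` with vanishing cross product are proportional. -/
theorem exists_eq_mul_of_cross_eq_zero {K : Type*} [Field K] {a₀ a₁ a₂ c₀ c₁ c₂ : K}
    (ha : ¬(a₀ = 0 ∧ a₁ = 0 ∧ a₂ = 0)) (h₀ : a₁ * c₂ - a₂ * c₁ = 0)
    (h₁ : a₂ * c₀ - a₀ * c₂ = 0) (h₂ : a₀ * c₁ - a₁ * c₀ = 0) :
    ∃ t, c₀ = t * a₀ ∧ c₁ = t * a₁ ∧ c₂ = t * a₂ := by
  by_cases h : a₀ = 0
  · by_cases h' : a₁ = 0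
    · have h'' : a₂ ≠ 0 := fun h'' => ha ⟨h, h', h''⟩
      refine ⟨c₂ / a₂, ?_, ?_, ?_⟩ <;> field_simp <;> grind
    · refine ⟨c₁ / a₁, ?_, ?_, ?_⟩ <;> field_simp <;> grind
  · refine ⟨c₀ / a₀, ?_, ?_, ?_⟩ <;> field_simp <;> grind

/-- The form `[162] + [243] + [135]` on `K⁶`. -/
noncomputable def hexForm (K : Type*) [Field K] : AlternatingMap K (Fin 6 → K) K (Fin 3) :=
  trip 0 5 1 + trip 1 3 2 + trip 0 2 4

theorem hexForm_apply {K : Type*} [Field K] (u v x : Fin 6 → K) :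
    hexForm K ![u, v, x] =
      -((u 1 * v 2 - u 2 * v 1) * x 3 + (u 2 * v 0 - u 0 * v 2) * x 4 +
        (u 0 * v 1 - u 1 * v 0) * x 5 +
        (u 4 * v 2 - u 5 * v 1 + (u 1 * v 5 - u 2 * v 4)) * x 0 +
        (u 5 * v 0 - u 3 * v 2 + (u 2 * v 3 - u 0 * v 5)) * x 1 +
        (u 3 * v 1 - u 4 * v 0 + (u 0 * v 4 - u 1 * v 3)) * x 2) := by
  have h (i j k : Fin 6) : trip i j k ![u, v, x] =
      Matrix.det !![u i, u j, u k; v i, v j, v k; x i, x j, x k] := by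
    change Matrix.det (_ : Matrix (Fin 3) (Fin 3) K) = _
    congr 1
    ext p q
    fin_cases p <;> fin_cases q <;> rfl
  simp only [hexForm, AlternatingMap.add_apply, h, Matrix.det_fin_three]
  simp
  ring

theorem mem_trilinRad_hexForm {K : Type*} [Field K] (u v : Fin 6 → K) :
    v ∈ trilinRad (hexForm K) u ↔
      (u 1 * v 2 - u 2 * v 1 = 0 ∧ u 2 * v 0 - u 0 * v 2 = 0 ∧ u 0 * v 1 - u 1 * v 0 = 0) ∧
        u 4 * v 2 - u 5 * v 1 + (u 1 * v 5 - u 2 * v 4) = 0 ∧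
        u 5 * v 0 - u 3 * v 2 + (u 2 * v 3 - u 0 * v 5) = 0 ∧
        u 3 * v 1 - u 4 * v 0 + (u 0 * v 4 - u 1 * v 3) = 0 := by
  change (∀ x, hexForm K ![u, v, x] = 0) ↔ _
  simp only [hexForm_apply]
  constructor
  · intro h
    have h' (i : Fin 6) := h (Pi.single i 1)
    refine ⟨⟨?_, ?_, ?_⟩, ?_, ?_, ?_⟩
    · simpa [-neg_sub] using h' 3
    · simpa [-neg_sub] using h' 4
    · simpa [-neg_sub] using h' 5
    · simpa [-neg_add_rev] using h' 0
    · simpa [-neg_add_rev] using h' 1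
    · simpa [-neg_add_rev] using h' 2
  · rintro ⟨⟨h₀, h₁, h₂⟩, h₃, h₄, h₅⟩ x
    simp [h₀, h₁, h₂, h₃, h₄, h₅]

theorem mem_span_single_zero_one_two {K : Type*} [Field K] (u : Fin 6 → K) :
    u ∈ Submodule.span K
        ({Pi.single 0 1, Pi.single 1 1, Pi.single 2 1} : Set (Fin 6 → K)) ↔
      u 3 = 0 ∧ u 4 = 0 ∧ u 5 = 0 := by
  rw [Submodule.mem_span_triple]
  constructor
  · rintro ⟨a, b, c, rfl⟩
    simp
  · rintro ⟨h₃, h₄, h₅⟩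
    refine ⟨u 0, u 1, u 2, ?_⟩
    ext i
    fin_cases i <;> simp [h₃, h₄, h₅]

theorem mem_span_single_three_four_five {K : Type*} [Field K] (u : Fin 6 → K) :
    u ∈ Submodule.span K
        ({Pi.single 3 1, Pi.single 4 1, Pi.single 5 1} : Set (Fin 6 → K)) ↔
      u 0 = 0 ∧ u 1 = 0 ∧ u 2 = 0 := by
  rw [Submodule.mem_span_triple]
  constructor
  · rintro ⟨a, b, c, rfl⟩
    simp
  · rintro ⟨h₀, h₁, h₂⟩
    refine ⟨u 3, u 4, u 5, ?_⟩
    ext i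
    fin_cases i <;> simp [h₀, h₁, h₂]

/-- For `u = (0, b)` with `b ≠ 0`, the radical of `u` consists of the `(t • b, d)`. -/
theorem finrank_trilinRad_hexForm_eq_four {K : Type*} [Field K] {u : Fin 6 → K} (hu : u ≠ 0)
    (h : u 0 = 0 ∧ u 1 = 0 ∧ u 2 = 0) : finrank K (trilinRad (hexForm K) u) = 4 := by
  obtain ⟨h₀, h₁, h₂⟩ := h
  have hb : ¬(u 3 = 0 ∧ u 4 = 0 ∧ u 5 = 0) := by
    rintro ⟨h₃, h₄, h₅⟩
    exact hu (by ext i; fin_cases i <;> assumption)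
  let g : (Fin 4 → K) →ₗ[K] (Fin 6 → K) :=
    { toFun := fun p => ![p 0 * u 3, p 0 * u 4, p 0 * u 5, p 1, p 2, p 3]
      map_add' := fun p q => by ext i; fin_cases i <;> simp [add_mul]
      map_smul' := fun c p => by ext i; fin_cases i <;> simp [mul_assoc] }
  have hg : Function.Injective g := by
    rw [injective_iff_map_eq_zero]
    intro p hp
    have hp' (i : Fin 6) : (![p 0 * u 3, p 0 * u 4, p 0 * u 5, p 1, p 2, p 3] : Fin 6 → K) i = 0 :=
      congrFun hp i
    have hp₀ : p 0 = 0 := by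
      by_contra hne
      exact hb ⟨by simpa [hne] using hp' 0, by simpa [hne] using hp' 1,
        by simpa [hne] using hp' 2⟩
    ext i
    fin_cases i
    exacts [hp₀, hp' 3, hp' 4, hp' 5]
  have hrange : trilinRad (hexForm K) u = LinearMap.range g := by
    ext v
    rw [mem_trilinRad_hexForm, LinearMap.mem_range]
    simp only [h₀, h₁, h₂, zero_mul, sub_zero, add_zero, true_and]
    constructor
    · rintro ⟨h₃, h₄, h₅⟩
      obtain ⟨t, ht₀, ht₁, ht₂⟩ := exists_eq_mul_of_cross_eq_zero hb h₃ h₄ h₅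
      refine ⟨![t, v 3, v 4, v 5], ?_⟩
      ext i
      fin_cases i <;> simp [g, ht₀, ht₁, ht₂]
    · rintro ⟨p, rfl⟩
      refine ⟨?_, ?_, ?_⟩ <;> simp [g] <;> ring
  rw [hrange, LinearMap.finrank_range_of_inj hg, finrank_fin_fun]

/-- For `u = (a, b)` with `a ≠ 0`, the radical of `u` is spanned by `u` and `(0, a)`. -/
theorem trilinRad_hexForm_eq_span {K : Type*} [Field K] {u : Fin 6 → K}
    (h : ¬(u 0 = 0 ∧ u 1 = 0 ∧ u 2 = 0)) :
    trilinRad (hexForm K) u = Submodule.span K {u, ![0, 0, 0, u 0, u 1, u 2]} := by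
  ext v
  rw [mem_trilinRad_hexForm, Submodule.mem_span_pair]
  constructor
  · rintro ⟨⟨h₀, h₁, h₂⟩, h₃, h₄, h₅⟩
    obtain ⟨t, ht₀, ht₁, ht₂⟩ := exists_eq_mul_of_cross_eq_zero h h₀ h₁ h₂
    rw [ht₁, ht₂] at h₃
    rw [ht₀, ht₂] at h₄
    rw [ht₀, ht₁] at h₅
    obtain ⟨s, hs₀, hs₁, hs₂⟩ := exists_eq_mul_of_cross_eq_zero h
      (c₀ := v 3 - t * u 3) (c₁ := v 4 - t * u 4) (c₂ := v 5 - t * u 5)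
      (by linear_combination h₃) (by linear_combination h₄) (by linear_combination h₅)
    refine ⟨t, s, ?_⟩
    ext i
    fin_cases i <;> simp [ht₀, ht₁, ht₂, ← hs₀, ← hs₁, ← hs₂]
  · rintro ⟨t, s, rfl⟩
    refine ⟨⟨?_, ?_, ?_⟩, ?_, ?_, ?_⟩ <;> simp <;> ring

theorem finrank_trilinRad_hexForm_eq_two {K : Type*} [Field K] {u : Fin 6 → K}
    (h : ¬(u 0 = 0 ∧ u 1 = 0 ∧ u 2 = 0)) : finrank K (trilinRad (hexForm K) u) = 2 := by
  have hli : LinearIndependent K ![u, ![0, 0, 0, u 0, u 1, u 2]] := by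
    rw [LinearIndependent.pair_iff]
    intro s t hst
    have hst' (i : Fin 6) := congrFun hst i
    have hs : s = 0 := by
      by_contra hne
      exact h ⟨by simpa [hne] using hst' 0, by simpa [hne] using hst' 1,
        by simpa [hne] using hst' 2⟩
    subst hs
    refine ⟨rfl, ?_⟩
    by_contra hne
    exact h ⟨by simpa [hne] using hst' 3, by simpa [hne] using hst' 4,
      by simpa [hne] using hst' 5⟩
  have hspan := finrank_span_eq_card hli
  rw [Matrix.range_cons, Matrix.range_cons, Matrix.range_empty, Set.union_empty,
    Set.singleton_union] at hspan
  rw [trilinRad_hexForm_eq_span h, hspan, Fintype.card_fin]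

/-- for `χ = [162] + [243] + [135]` on `K^6`, with `V₀ = span(e₁,e₂,e₃)`,
`V₁ = span(e₄,e₅,e₆)` and `ω` the coordinate swap `(u₁,…,u₆) ↦ (u₄,u₅,u₆,u₁,u₂,u₃)`:
(i) every nonzero `u` is a pole, with `dim Rad = 4` on `V₁` and `dim Rad = 2` off `V₁`;
(ii) a 2-dimensional subspace is in the upper radical iff it lies in `V₁` or has the
form `span{a + b, ω(a)}` with `0 ≠ a ∈ V₀`, `b ∈ V₁`. -/
theorem stmt11 (K : Type*) [Field K]
    (χ : AlternatingMap K (Fin 6 → K) K (Fin 3))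
    (hχ : χ = trip 0 5 1 + trip 1 3 2 + trip 0 2 4)
    (V₀ V₁ : Submodule K (Fin 6 → K))
    (hV₀ : V₀ = Submodule.span K
      ({Pi.single 0 1, Pi.single 1 1, Pi.single 2 1} : Set (Fin 6 → K)))
    (hV₁ : V₁ = Submodule.span K
      ({Pi.single 3 1, Pi.single 4 1, Pi.single 5 1} : Set (Fin 6 → K)))
    (ω : (Fin 6 → K) →ₗ[K] (Fin 6 → K))
    (hω : ω = LinearMap.funLeft K K (fun i : Fin 6 => i + 3)) :
    (∀ u : Fin 6 → K, u ≠ 0 →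
      ((u ∈ V₁ → Module.finrank K (trilinRad χ u) = 4) ∧
        (u ∉ V₁ → Module.finrank K (trilinRad χ u) = 2))) ∧
    (∀ ℓ : Submodule K (Fin 6 → K), Module.finrank K ℓ = 2 →
      ((∀ u : Fin 6 → K, ∀ x ∈ ℓ, ∀ y ∈ ℓ, χ ![u, x, y] = 0) ↔
        (ℓ ≤ V₁ ∨
          ∃ a ∈ V₀, a ≠ 0 ∧ ∃ b ∈ V₁,
            ℓ = Submodule.span K ({a + b, ω a} : Set (Fin 6 → K))))) := by
  have hχ' : χ = hexForm K := hχ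
  subst hχ' hV₀ hV₁ hω
  simp only [mem_span_single_zero_one_two, mem_span_single_three_four_five]
  refine ⟨fun u hu => ⟨finrank_trilinRad_hexForm_eq_four hu, finrank_trilinRad_hexForm_eq_two⟩,
    fun ℓ hℓ => ⟨fun h => ?_, ?_⟩⟩
  · rw [or_iff_not_imp_left, SetLike.not_le_iff_exists]
    rintro ⟨u, hu, hu'⟩
    rw [mem_span_single_three_four_five] at hu'
    have hle : ℓ ≤ trilinRad (hexForm K) u := by
      intro v hv x
      have hx := h x u hu v hv
      rw [hexForm_apply] at hx ⊢
      linear_combination hx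
    have heq := Submodule.eq_of_le_of_finrank_eq hle
      (hℓ.trans (finrank_trilinRad_hexForm_eq_two hu').symm)
    refine ⟨![u 0, u 1, u 2, 0, 0, 0], ⟨rfl, rfl, rfl⟩, fun h0 => hu' ?_,
      ![0, 0, 0, u 3, u 4, u 5], ⟨rfl, rfl, rfl⟩, ?_⟩
    · exact ⟨congrFun h0 0, congrFun h0 1, congrFun h0 2⟩
    · rw [heq, trilinRad_hexForm_eq_span hu']
      congr 2
      · ext i
        fin_cases i <;> simp
      · congr 1
        ext i
        fin_cases i <;> rfl
  · rintro (h | ⟨a, ⟨ha₃, ha₄, ha₅⟩, -, b, ⟨hb₀, hb₁, hb₂⟩, rfl⟩) u x hx y hy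
    · obtain ⟨hx₀, hx₁, hx₂⟩ := (mem_span_single_three_four_five x).1 (h hx)
      obtain ⟨hy₀, hy₁, hy₂⟩ := (mem_span_single_three_four_five y).1 (h hy)
      simp [hexForm_apply, hx₀, hx₁, hx₂, hy₀, hy₁, hy₂]
    · obtain ⟨s, t, rfl⟩ := Submodule.mem_span_pair.1 hx
      obtain ⟨s', t', rfl⟩ := Submodule.mem_span_pair.1 hy
      have e₀ : (0 : Fin 6) + 3 = 3 := rfl
      have e₁ : (1 : Fin 6) + 3 = 4 := rfl
      have e₂ : (2 : Fin 6) + 3 = 5 := rfl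
      have e₃ : (3 : Fin 6) + 3 = 0 := rfl
      have e₄ : (4 : Fin 6) + 3 = 1 := rfl
      have e₅ : (5 : Fin 6) + 3 = 2 := rfl
      simp only [hexForm_apply, Pi.add_apply, Pi.smul_apply, smul_eq_mul,
        LinearMap.funLeft_apply, e₀, e₁, e₂, e₃, e₄, e₅, ha₃, ha₄, ha₅, hb₀, hb₁, hb₂]
      ring
end

section
/- Let K be a field, V = K^6, and let χ be a nonzero alternating trilinear form on V whose upper radical R↑(χ) is a line spread of the projective space of V, i.e., every nonzero vector of V lies in exactly one member of R↑(χ). Then R↑(χ) is a normal spread: for any two distinct members ℓ₁, ℓ₂ ∈ R↑(χ), setting Σ := ℓ₁ + ℓ₂ (a 4-dimensional subspace), one has (i) χ(x, y, z) = 0 for all x, y, z ∈ Σ, and (ii) for every nonzero p ∈ Σ, the unique member of R↑(χ) containing p is contained in Σ. -/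
open Module

section TrilinearForm

variable {K V : Type*} [Field K] [AddCommGroup V] [Module K V]

theorem AlternatingMap.map_three_swap_left (χ : AlternatingMap K V K (Fin 3)) (x y z : V) :
    χ ![y, x, z] = -χ ![x, y, z] := by
  rw [← χ.map_swap ![x, y, z] (i := 0) (j := 1) (by decide)]
  congr 1
  funext i
  fin_cases i <;> rfl

theorem AlternatingMap.map_three_swap_right (χ : AlternatingMap K V K (Fin 3)) (x y z : V) :
    χ ![x, z, y] = -χ ![x, y, z] := by
  rw [← χ.map_swap ![x, y, z] (i := 1) (j := 2) (by decide)]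
  congr 1
  funext i
  fin_cases i <;> rfl

/-- The bilinear form `(x, y) ↦ χ(u, x, y)` obtained by fixing the first argument of `χ`. -/
def trilinSlice (χ : AlternatingMap K V K (Fin 3)) (u : V) : V →ₗ[K] V →ₗ[K] K :=
  LinearMap.mk₂ K (fun x y => χ ![u, x, y])
    (fun x x' y => (χ.curryLeft u).map_vecCons_add ![y] x x')
    (fun c x y => (χ.curryLeft u).map_vecCons_smul ![y] c x)
    (fun x y y' => ((χ.curryLeft u).curryLeft x).map_vecCons_add ![] y y')
    (fun c x y => ((χ.curryLeft u).curryLeft x).map_vecCons_smul ![] c y)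

@[simp]
theorem trilinSlice_apply (χ : AlternatingMap K V K (Fin 3)) (u x y : V) :
    trilinSlice χ u x y = χ ![u, x, y] := rfl

theorem trilinSlice_self (χ : AlternatingMap K V K (Fin 3)) (u x : V) :
    trilinSlice χ u x x = 0 :=
  χ.map_eq_zero_of_eq _ (i := 1) (j := 2) rfl (by decide)

/-- The upper radical of `χ`: the 2-dimensional subspaces `ℓ` with `χ(u, x, y) = 0` for all
`u ∈ V` and `x, y ∈ ℓ`. -/
def upperRadical (χ : AlternatingMap K V K (Fin 3)) : Set (Submodule K V) :=
  {ℓ | finrank K ℓ = 2 ∧ ∀ u : V, ∀ x ∈ ℓ, ∀ y ∈ ℓ, χ ![u, x, y] = 0}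

theorem ker_trilinSlice (χ : AlternatingMap K V K (Fin 3)) (u : V) :
    LinearMap.ker (trilinSlice χ u) = trilinRad χ u := by
  ext v
  exact LinearMap.ext_iff

theorem span_pair_mem_upperRadical {χ : AlternatingMap K V K (Fin 3)} {p v : V} (hp : p ≠ 0)
    (hv : v ∈ trilinRad χ p) (hpv : v ∉ Submodule.span K {p}) :
    Submodule.span K {p, v} ∈ upperRadical χ := by
  constructor
  · have hli : LinearIndependent K ![p, v] := by
      rw [LinearIndependent.pair_iff' hp]
      exact fun a ha => hpv (Submodule.mem_span_singleton.2 ⟨a, ha⟩)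
    rw [← Matrix.range_cons_cons_empty p v ![], finrank_span_eq_card hli, Fintype.card_fin]
  · intro u x hx y hy
    obtain ⟨a, b, rfl⟩ := Submodule.mem_span_pair.1 hx
    obtain ⟨c, d, rfl⟩ := Submodule.mem_span_pair.1 hy
    have hpv' : trilinSlice χ u p v = 0 := by
      rw [trilinSlice_apply, χ.map_three_swap_left, χ.map_three_swap_right, hv u, neg_zero,
        neg_zero]
    have hvp : trilinSlice χ u v p = 0 := by
      rw [trilinSlice_apply, χ.map_three_swap_right, ← trilinSlice_apply, hpv', neg_zero]
    rw [← trilinSlice_apply]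
    simp only [map_add, map_smul, LinearMap.add_apply, LinearMap.smul_apply, hpv', hvp,
      trilinSlice_self, smul_zero, add_zero]

/-- If only one member of the upper radical passes through `p ≠ 0`, it contains the radical
of `p`. -/
theorem trilinRad_le_of_unique {χ : AlternatingMap K V K (Fin 3)} {p : V} (hp : p ≠ 0)
    {ℓ : Submodule K V} (hpℓ : p ∈ ℓ) (huniq : ∀ m ∈ upperRadical χ, p ∈ m → m = ℓ) :
    trilinRad χ p ≤ ℓ := by
  intro v hv
  by_cases hpv : v ∈ Submodule.span K {p}
  · exact (Submodule.span_singleton_le_iff_mem _ _).2 hpℓ hpv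
  · rw [← huniq _ (span_pair_mem_upperRadical hp hv hpv)
      (Submodule.subset_span (by simp))]
    exact Submodule.subset_span (by simp)

/-- `χ` vanishes on the sum of two members of its upper radical. -/
theorem upperRadical.map_sup_eq_zero {χ : AlternatingMap K V K (Fin 3)} {ℓ₁ ℓ₂ : Submodule K V}
    (h₁ : ℓ₁ ∈ upperRadical χ) (h₂ : ℓ₂ ∈ upperRadical χ) {x y z : V}
    (hx : x ∈ ℓ₁ ⊔ ℓ₂) (hy : y ∈ ℓ₁ ⊔ ℓ₂) (hz : z ∈ ℓ₁ ⊔ ℓ₂) : χ ![x, y, z] = 0 := by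
  have outer {ℓ : Submodule K V} (h : ℓ ∈ upperRadical χ) {x y : V} (hx : x ∈ ℓ) (hy : y ∈ ℓ)
      (u : V) : χ ![x, u, y] = 0 := by
    rw [χ.map_three_swap_left, h.2 u x hx y hy, neg_zero]
  have left {ℓ : Submodule K V} (h : ℓ ∈ upperRadical χ) {x y : V} (hx : x ∈ ℓ) (hy : y ∈ ℓ)
      (u : V) : χ ![x, y, u] = 0 := by
    rw [χ.map_three_swap_right, outer h hx hy, neg_zero]
  obtain ⟨x₁, hx₁, x₂, hx₂, rfl⟩ := Submodule.mem_sup.1 hx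
  obtain ⟨y₁, hy₁, y₂, hy₂, rfl⟩ := Submodule.mem_sup.1 hy
  obtain ⟨z₁, hz₁, z₂, hz₂, rfl⟩ := Submodule.mem_sup.1 hz
  rw [χ.map_vecCons_add]
  simp only [← trilinSlice_apply, map_add, LinearMap.add_apply]
  simp only [trilinSlice_apply, left h₁ hx₁ hy₁, left h₂ hx₂ hy₂, outer h₁ hx₁ hz₁,
    outer h₂ hx₂ hz₂, h₁.2 x₂ _ hy₁ _ hz₁, h₂.2 x₁ _ hy₂ _ hz₂, add_zero]

/-- A totally isotropic subspace `W` of a bilinear form whose left radical lies in `W'` satisfies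
`2 * dim W ≤ dim V + dim W'`. -/
theorem LinearMap.two_mul_finrank_le_of_isotropic [FiniteDimensional K V]
    (B : V →ₗ[K] V →ₗ[K] K) {W W' : Submodule K V} (hB : LinearMap.ker B ≤ W')
    (hW : ∀ x ∈ W, ∀ y ∈ W, B x y = 0) :
    2 * finrank K W ≤ finrank K V + finrank K W' := by
  have hrange : finrank K (LinearMap.range (B.domRestrict W)) ≤
      finrank K W.dualAnnihilator := by
    apply Submodule.finrank_mono
    rintro _ ⟨x, rfl⟩
    exact (Submodule.mem_dualAnnihilator _).2 (hW x x.2)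
  have hker : finrank K (LinearMap.ker (B.domRestrict W)) ≤ finrank K W' := by
    rw [(Submodule.equivMapOfInjective W.subtype W.injective_subtype _).finrank_eq]
    apply Submodule.finrank_mono
    rintro _ ⟨x, hx, rfl⟩
    exact hB hx
  have hsum := (B.domRestrict W).finrank_range_add_finrank_ker
  have hann := Subspace.finrank_add_finrank_dualAnnihilator_eq W
  lia

end TrilinearForm

/-- if the upper radical of a nonzero alternating trilinear form `χ` on
`K^6` is a line spread (every nonzero vector lies in exactly one 2-dimensional subspace
belonging to the upper radical), then the spread is normal: for distinct spread lines
`ℓ₁, ℓ₂`, the subspace `Σ = ℓ₁ + ℓ₂` is 4-dimensional, `χ` vanishes identically on `Σ`,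
and every spread line through a nonzero point of `Σ` is contained in `Σ`. -/
theorem stmt14 (K : Type*) [Field K]
    (χ : AlternatingMap K (Fin 6 → K) K (Fin 3)) (hχ : χ ≠ 0)
    (hspread : ∀ v : Fin 6 → K, v ≠ 0 →
      ∃! ℓ : Submodule K (Fin 6 → K),
        (Module.finrank K ℓ = 2 ∧
          ∀ u : Fin 6 → K, ∀ x ∈ ℓ, ∀ y ∈ ℓ, χ ![u, x, y] = 0) ∧ v ∈ ℓ) :
    ∀ ℓ₁ ℓ₂ : Submodule K (Fin 6 → K),
      (Module.finrank K ℓ₁ = 2 ∧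
        ∀ u : Fin 6 → K, ∀ x ∈ ℓ₁, ∀ y ∈ ℓ₁, χ ![u, x, y] = 0) →
      (Module.finrank K ℓ₂ = 2 ∧
        ∀ u : Fin 6 → K, ∀ x ∈ ℓ₂, ∀ y ∈ ℓ₂, χ ![u, x, y] = 0) →
      ℓ₁ ≠ ℓ₂ →
      (Module.finrank K ↥(ℓ₁ ⊔ ℓ₂) = 4 ∧
        (∀ x ∈ ℓ₁ ⊔ ℓ₂, ∀ y ∈ ℓ₁ ⊔ ℓ₂, ∀ z ∈ ℓ₁ ⊔ ℓ₂, χ ![x, y, z] = 0) ∧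
        (∀ p ∈ ℓ₁ ⊔ ℓ₂, p ≠ 0 →
          ∀ ℓ : Submodule K (Fin 6 → K),
            (Module.finrank K ℓ = 2 ∧
              ∀ u : Fin 6 → K, ∀ x ∈ ℓ, ∀ y ∈ ℓ, χ ![u, x, y] = 0) →
            p ∈ ℓ → ℓ ≤ ℓ₁ ⊔ ℓ₂)) := by
  intro ℓ₁ ℓ₂ h₁ h₂ hne
  have huniq {p : Fin 6 → K} (hp : p ≠ 0) {ℓ m : Submodule K (Fin 6 → K)}
      (hℓ : ℓ ∈ upperRadical χ) (hm : m ∈ upperRadical χ) (hpℓ : p ∈ ℓ) (hpm : p ∈ m) : m = ℓ :=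
    (hspread p hp).unique ⟨hm, hpm⟩ ⟨hℓ, hpℓ⟩
  have hinf : ℓ₁ ⊓ ℓ₂ = ⊥ := by
    by_contra hbot
    obtain ⟨p, hp, hp0⟩ := Submodule.exists_mem_ne_zero_of_ne_bot hbot
    exact hne (huniq hp0 h₂ h₁ hp.2 hp.1)
  have hdim : finrank K ↥(ℓ₁ ⊔ ℓ₂) = 4 := by
    have h := Submodule.finrank_sup_add_finrank_inf_eq ℓ₁ ℓ₂
    rw [hinf, finrank_bot, h₁.1, h₂.1] at h
    exact h
  refine ⟨hdim, fun x hx y hy z hz => upperRadical.map_sup_eq_zero h₁ h₂ hx hy hz, ?_⟩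
  intro p hp hp0 ℓ hℓ hpℓ
  have hrad : trilinRad χ p ≤ ℓ :=
    trilinRad_le_of_unique hp0 hpℓ fun m hm hpm => huniq hp0 hℓ hm hpℓ hpm
  have hisotropic : ∀ x ∈ (ℓ₁ ⊔ ℓ₂) ⊔ ℓ, ∀ y ∈ (ℓ₁ ⊔ ℓ₂) ⊔ ℓ, trilinSlice χ p x y = 0 := by
    intro x hx y hy
    obtain ⟨x₁, hx₁, x₂, hx₂, rfl⟩ := Submodule.mem_sup.1 hx
    obtain ⟨y₁, hy₁, y₂, hy₂, rfl⟩ := Submodule.mem_sup.1 hy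
    have hmem {z : Fin 6 → K} (hz : z ∈ ℓ) (u : Fin 6 → K) : χ ![p, z, u] = 0 := by
      rw [χ.map_three_swap_right, χ.map_three_swap_left, hℓ.2 u p hpℓ z hz, neg_zero, neg_zero]
    simp only [map_add, LinearMap.add_apply, trilinSlice_apply]
    rw [χ.map_three_swap_right p y₂ x₁, hmem hx₂, hmem hx₂, hmem hy₂,
      upperRadical.map_sup_eq_zero h₁ h₂ hp hx₁ hy₁]
    simp
  have hbound := LinearMap.two_mul_finrank_le_of_isotropic (trilinSlice χ p)
    ((ker_trilinSlice χ p).trans_le hrad) hisotropic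
  rw [hℓ.1, finrank_fin_fun] at hbound
  rw [← sup_eq_left]
  exact (Submodule.eq_of_le_of_finrank_le le_sup_left (by lia)).symm
end
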